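/- Let N ≥ 1, m ≥ 1, N/(N+m) < p ≤ 1, and fix an integer L > N(1/p − 1). There exists a constant c > 0 (depending only on N, m, p, L and φ₀) such that for every f ∈ C_c^{2m−1}(ℝ^N) and every α > 0 there exist a function g on ℝ^N, C^m functions β_k (k ∈ ℕ) and closed cubes Q_k^* with sides of length ℓ_k parallel to the axes, such that: (i) f = g + Σ_k β_k, where for each point of ℝ^N only finitely many β_k are nonzero, and |g(x)| ≤ cα for almost every x; (ii) each β_k is supported in Q_k^*, and for i = 0,1,…,m−1 one has Σ_{|β|=i}‖∂^β β_k‖_{L^∞} ≤ c Σ_{j=0}^{i} ℓ_k^{m+j−i} Σ_{|β|=m+j}‖∂^β f‖_{L^∞}; for i = 1,…,m one has Σ_{|β|=i}‖∂^β β_k‖_{L^∞} ≤ c Σ_{|β|=i}‖∂^β f‖_{L^∞}; moreover ∫_{ℝ^N} ( sup_{t>0} |(β_k ∗ φ₀,ₜ)(x)| )^p dx ≤ c ∫_{Q_k^*} (𝓜f(x))^p dx, and ∫ x^γ β_k(x) dx = 0 for all multi-indices |γ| ≤ m−1; (iii) no point of ℝ^N belongs to more than c of the cubes Q_k^*, and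 ⋃_k Q_k^* = {x ∈ ℝ^N : 𝓜f(x) > α}. -/

import Mathlib

open MeasureTheory Set Metric Filter
open scoped ENNReal NNReal Topology

noncomputable section

abbrev RN (N : ℕ) := EuclideanSpace ℝ (Fin N)

variable {N : ℕ}

/-- Partial derivative in the `i`-th coordinate direction. -/
def pd {E : Type*} [NormedAddCommGroup E] [NormedSpace ℝ E] (i : Fin N)
    (f : RN N → E) : RN N → E :=
  fun x => fderiv ℝ f x (EuclideanSpace.single i 1)

/-- Multi-index partial derivative `∂^α`. -/
def md {E : Type*} [NormedAddCommGroup E] [NormedSpace ℝ E] (α : Fin N → ℕ)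
    (f : RN N → E) : RN N → E :=
  ((List.ofFn fun i : Fin N => (pd i)^[α i]).foldr (· ∘ ·) id) f

/-- Order `|α|` of a multi-index. -/
def mOrder (α : Fin N → ℕ) : ℕ := ∑ i, α i

/-- Multi-indices of order at most `k`. -/
def idxLe (N k : ℕ) : Finset (Fin N → ℕ) :=
  (Fintype.piFinset fun _ : Fin N => Finset.range (k + 1)).filter fun α => mOrder α ≤ k

/-- Multi-indices of order exactly `k`. -/
def idxEq (N k : ℕ) : Finset (Fin N → ℕ) :=
  (Fintype.piFinset fun _ : Fin N => Finset.range (k + 1)).filter fun α => mOrder α = k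

/-- The dilate `φ_t(z) = t^{-N} φ(z/t)`. -/
def dil (φ : RN N → ℝ) (t : ℝ) (z : RN N) : ℝ := φ (t⁻¹ • z) / t ^ N

/-- Convolution `(u * φ_t)(x)`. -/
def convAt (φ : RN N → ℝ) (t : ℝ) (u : RN N → ℂ) (x : RN N) : ℂ :=
  ∫ y, dil φ t (x - y) • u y

/-- The small maximal function `sup_{0<t<1} |(u * φ_t)(x)|`. -/
def smallMax (φ : RN N → ℝ) (u : RN N → ℂ) (x : RN N) : ℝ≥0∞ :=
  ⨆ t ∈ Ioo (0 : ℝ) 1, ENNReal.ofReal ‖convAt φ t u x‖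

/-- The localizable Hardy space quasi-norm `‖u‖_{h^p}` (for `0 < p < ∞`). -/
def hNorm (φ : RN N → ℝ) (p : ℝ) (u : RN N → ℂ) : ℝ≥0∞ :=
  (∫⁻ x, smallMax φ u x ^ p) ^ (1 / p)

/-- A fixed radial nonnegative smooth function supported in the unit ball with integral 1. -/
structure GoodPhi (φ : RN N → ℝ) : Prop where
  smooth : ContDiff ℝ (⊤ : ℕ∞) φ
  nonneg : ∀ x, 0 ≤ φ x
  radial : ∀ x y : RN N, ‖x‖ = ‖y‖ → φ x = φ y
  supp : tsupport φ ⊆ closedBall 0 1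
  int_one : ∫ x, φ x = 1

/-- The closed axes-parallel cube with center `c` and side length `ℓ`. -/
def cube (c : RN N) (ℓ : ℝ) : Set (RN N) := {y | ∀ i, |y i - c i| ≤ ℓ / 2}

/-- The open axes-parallel cube with center `c` and side length `ℓ`
(the interior of `cube c ℓ` when `ℓ > 0`). -/
def openCube (c : RN N) (ℓ : ℝ) : Set (RN N) := {y | ∀ i, |y i - c i| < ℓ / 2}

/-- `P` is a (complex) polynomial in `N` variables of degree at most `d`. -/
def IsPolyDegLE (N d : ℕ) (P : RN N → ℂ) : Prop :=
  ∃ c : (Fin N → ℕ) → ℂ, ∀ x : RN N, P x = ∑ α ∈ idxLe N d, c α * ∏ i, ((x i : ℝ) : ℂ) ^ α i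

/-- The family `𝓕_L(y,s)` of normalized bump functions supported in `B(y,s)`. -/
def calF (L : ℕ) (y : RN N) (s : ℝ) : Set (RN N → ℝ) :=
  {ψ | ContDiff ℝ (⊤ : ℕ∞) ψ ∧ HasCompactSupport ψ ∧ tsupport ψ ⊆ ball y s ∧
    ∀ α : Fin N → ℕ, mOrder α ≤ L → ∀ z, |md α ψ z| ≤ (s ^ (N + mOrder α))⁻¹}

/-- The grand maximal function `𝓜f(x) = sup { |∫ fψ| : ψ ∈ 𝓕_L(x,t), t > 0 }`. -/
def grandMax (L : ℕ) (f : RN N → ℂ) (x : RN N) : ℝ≥0∞ :=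
  ⨆ (t : ℝ) (_ : 0 < t) (ψ : RN N → ℝ) (_ : ψ ∈ calF L x t),
    ENNReal.ofReal ‖∫ z, ψ z • f z‖

/-- `Σ_{|α| = i} ‖∂^α f‖_{L^∞}` (as a supremum). -/
def supDeriv (i : ℕ) (f : RN N → ℂ) : ℝ :=
  ∑ α ∈ idxEq N i, ⨆ z : RN N, ‖md α f z‖

section IteratedDirectionalDerivatives

variable {E F : Type*} [NormedAddCommGroup E] [NormedSpace ℝ E]
  [NormedAddCommGroup F] [NormedSpace ℝ F]

/-- Iterated directional derivative along a list of vectors, the head being applied last. -/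
def iterDir : List E → (E → F) → E → F
  | [], f => f
  | v :: l, f => fun x => fderiv ℝ (iterDir l f) x v

lemma iterDir_append (l₁ l₂ : List E) (f : E → F) :
    iterDir (l₁ ++ l₂) f = iterDir l₁ (iterDir l₂ f) := by
  induction l₁ with
  | nil => rfl
  | cons v l ih => simp only [List.cons_append, iterDir, ih]

lemma ContDiff.iterDir {f : E → F} (l : List E) {k : ℕ}
    (hf : ContDiff ℝ ((l.length + k : ℕ) : ℕ∞) f) : ContDiff ℝ (k : ℕ∞) (iterDir l f) := by
  induction l generalizing k with
  | nil => simpa [_root_.iterDir] using hf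
  | cons v l ih =>
    have h : ContDiff ℝ ((k + 1 : ℕ) : ℕ∞) (_root_.iterDir l f) := by
      apply ih
      convert hf using 3
      simp only [List.length_cons]; ring
    exact (h.fderiv_right (m := (k : ℕ∞)) (by norm_cast)).clm_apply contDiff_const

lemma iterDir_perm {l₁ l₂ : List E} (h : l₁.Perm l₂) {f : E → F}
    (hf : ContDiff ℝ ((l₁.length : ℕ) : ℕ∞) f) : iterDir l₁ f = iterDir l₂ f := by
  induction h with
  | nil => rfl
  | cons v h ih =>
    simp only [iterDir]
    rw [ih (hf.of_le (by simp))]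
  | swap v w l =>
    funext x
    have h2 : ContDiff ℝ ((2 : ℕ) : ℕ∞) (iterDir l f) := ContDiff.iterDir l (by
      convert hf using 3; simp)
    have hs : IsSymmSndFDerivAt ℝ (iterDir l f) x :=
      h2.contDiffAt.isSymmSndFDerivAt (by simp)
    have hd : Differentiable ℝ (fderiv ℝ (iterDir l f)) :=
      (h2.fderiv_right (m := ((1 : ℕ) : ℕ∞)) (by norm_cast)).differentiable (by simp)
    simp only [iterDir]
    rw [fderiv_clm_apply (hd x) (differentiableAt_const _),
      fderiv_clm_apply (hd x) (differentiableAt_const _)]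
    simpa using hs w v
  | trans h₁ h₂ ih₁ ih₂ =>
    rw [ih₁ hf, ih₂ (by rw [← h₁.length_eq]; exact hf)]

lemma iteratedFDeriv_apply_eq_iterDir {n : ℕ} {f : E → F} (hf : ContDiff ℝ ((n : ℕ) : ℕ∞) f)
    (x : E) (v : Fin n → E) : iteratedFDeriv ℝ n f x v = iterDir (List.ofFn v) f x := by
  induction n generalizing x with
  | zero => simp [iterDir]
  | succ n ih =>
    have hf' : ContDiff ℝ ((n : ℕ) : ℕ∞) f := hf.of_le (by exact_mod_cast Nat.le_succ n)
    rw [iteratedFDeriv_succ_apply_left, List.ofFn_succ]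
    simp only [iterDir]
    have hfun : iterDir (List.ofFn fun i => v i.succ) f =
        fun y => iteratedFDeriv ℝ n f y (fun i => v i.succ) := by
      funext y; rw [ih hf']
    have hd : DifferentiableAt ℝ (iteratedFDeriv ℝ n f) x :=
      (hf.differentiable_iteratedFDeriv (by exact_mod_cast Nat.lt_succ_self n)) x
    rw [hfun, fderiv_continuousMultilinear_apply_const_apply hd]
    rfl

lemma iteratedFDeriv_comp_perm_of_contDiff {n : ℕ} {f : E → F}
    (hf : ContDiff ℝ ((n : ℕ) : ℕ∞) f) (x : E) (v : Fin n → E) (σ : Equiv.Perm (Fin n)) :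
    iteratedFDeriv ℝ n f x (fun i => v (σ i)) = iteratedFDeriv ℝ n f x v := by
  rw [iteratedFDeriv_apply_eq_iterDir hf, iteratedFDeriv_apply_eq_iterDir hf]
  refine congrFun (iterDir_perm ?_ (by simpa using hf)) x
  exact Equiv.Perm.ofFn_comp_perm σ v

end IteratedDirectionalDerivatives

section MultiIndex

variable {F : Type*} [NormedAddCommGroup F] [NormedSpace ℝ F]

lemma iterDir_replicate (i : Fin N) (k : ℕ) (f : RN N → F) :
    iterDir (List.replicate k (EuclideanSpace.single i (1 : ℝ))) f = (pd i)^[k] f := by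
  induction k with
  | zero => rfl
  | succ k ih =>
    rw [List.replicate_succ, Function.iterate_succ_apply']
    simp only [iterDir, ih]
    rfl

/-- The list of basis vectors, in increasing order, described by a multi-index. -/
def basisWord (α : Fin N → ℕ) : List (RN N) :=
  (List.ofFn fun i => List.replicate (α i) (EuclideanSpace.single i (1 : ℝ))).flatten

lemma length_basisWord (α : Fin N → ℕ) : (basisWord α).length = mOrder α := by
  simp [basisWord, mOrder, List.length_flatten, List.map_ofFn, List.sum_ofFn, Function.comp_def]

lemma md_eq_iterDir (α : Fin N → ℕ) (f : RN N → F) : md α f = iterDir (basisWord α) f := by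
  have key : ∀ l : List (Fin N), ((l.map fun i => (pd (E := F) i)^[α i]).foldr (· ∘ ·) id) f =
      iterDir (l.map fun i => List.replicate (α i) (EuclideanSpace.single i (1 : ℝ))).flatten f := by
    intro l
    induction l with
    | nil => rfl
    | cons i l ih =>
      simp only [List.map_cons, List.foldr_cons, List.flatten_cons, Function.comp_apply]
      rw [iterDir_append, ← ih, iterDir_replicate]
  have h := key (List.finRange N)
  rw [← List.ofFn_eq_map, ← List.ofFn_eq_map] at h
  exact h

lemma mem_idxEq {α : Fin N → ℕ} {k : ℕ} : α ∈ idxEq N k ↔ mOrder α = k := by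
  simp only [idxEq, Finset.mem_filter, Fintype.mem_piFinset, Finset.mem_range, and_iff_right_iff_imp]
  intro h i
  have : α i ≤ mOrder α := Finset.single_le_sum (f := α) (fun _ _ => Nat.zero_le _) (Finset.mem_univ i)
  omega

lemma norm_single_one_le (i : Fin N) : ‖(EuclideanSpace.single i (1 : ℝ) : RN N)‖ ≤ 1 := by
  simp

lemma norm_md_le {α : Fin N → ℕ} {f : RN N → F} (hf : ContDiff ℝ ((mOrder α : ℕ) : ℕ∞) f)
    (x : RN N) : ‖md α f x‖ ≤ ‖iteratedFDeriv ℝ (mOrder α) f x‖ := by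
  obtain ⟨v, hv, hv1⟩ : ∃ v : Fin (mOrder α) → RN N, List.ofFn v = basisWord α ∧
      ∀ i, ‖v i‖ ≤ 1 := by
    refine ⟨fun i => (basisWord α).get (i.cast (length_basisWord α).symm), ?_, ?_⟩
    · apply List.ext_get
      · simp [length_basisWord]
      · intro n h₁ h₂; simp
    · intro i
      have := List.get_mem (basisWord α) (i.cast (length_basisWord α).symm)
      simp only [basisWord, List.mem_flatten, List.mem_ofFn] at this
      obtain ⟨l, ⟨j, rfl⟩, hl⟩ := this
      have h1 := List.eq_of_mem_replicate hl
      change ‖(basisWord α).get (i.cast (length_basisWord α).symm)‖ ≤ 1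
      simp only [basisWord, h1]
      exact norm_single_one_le j
  rw [md_eq_iterDir, ← hv, ← iteratedFDeriv_apply_eq_iterDir hf]
  refine (ContinuousMultilinearMap.le_opNorm _ _).trans ?_
  refine mul_le_of_le_one_right (norm_nonneg _) ?_
  exact Finset.prod_le_one (fun i _ => norm_nonneg _) (fun i _ => hv1 i)

lemma iteratedFDeriv_single_eq_md {n : ℕ} {f : RN N → F} (hf : ContDiff ℝ ((n : ℕ) : ℕ∞) f)
    (r : Fin n → Fin N) : ∃ α ∈ idxEq N n, ∀ x,
      iteratedFDeriv ℝ n f x (fun s => EuclideanSpace.single (r s) (1 : ℝ)) = md α f x := by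
  set α : Fin N → ℕ := fun i => (List.ofFn r).count i with hα
  have hperm : (List.ofFn fun s => (EuclideanSpace.single (r s) (1 : ℝ) : RN N)).Perm
      (basisWord α) := by
    have h1 : (List.ofFn fun s => (EuclideanSpace.single (r s) (1 : ℝ) : RN N)) =
        (List.ofFn r).map (fun i => EuclideanSpace.single i (1 : ℝ)) := by
      rw [List.map_ofFn]; rfl
    have h2 : basisWord α = ((List.ofFn fun i => List.replicate (α i) i).flatten).map
        (fun i => EuclideanSpace.single i (1 : ℝ)) := by
      rw [List.map_flatten, List.map_ofFn]
      simp [basisWord, Function.comp_def]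
    rw [h1, h2]
    apply List.Perm.map
    rw [List.perm_iff_count]
    intro i
    rw [List.count_flatten, List.map_ofFn, List.sum_ofFn]
    simp [List.count_replicate, hα]
  have hlen : (List.ofFn fun s => (EuclideanSpace.single (r s) (1 : ℝ) : RN N)).length = n := by
    simp
  refine ⟨α, mem_idxEq.2 ?_, fun x => ?_⟩
  · rw [← length_basisWord, ← hperm.length_eq, hlen]
  · rw [iteratedFDeriv_apply_eq_iterDir hf, md_eq_iterDir]
    exact congrFun (iterDir_perm hperm (by rw [hlen]; exact hf)) x

lemma norm_multilinear_le_sum_basis {n : ℕ} (M : ContinuousMultilinearMap ℝ (fun _ : Fin n => RN N) F)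
    {B : ℝ} (hB : ∀ r : Fin n → Fin N, ‖M fun s => EuclideanSpace.single (r s) (1 : ℝ)‖ ≤ B) :
    ‖M‖ ≤ (N : ℝ) ^ n * B := by
  by_cases hB0 : 0 ≤ B
  swap
  · have hne : IsEmpty (Fin n → Fin N) := ⟨fun r => hB0 ((norm_nonneg _).trans (hB r))⟩
    have hN : N = 0 := by
      by_contra h
      exact hne.elim fun _ => ⟨0, Nat.pos_of_ne_zero h⟩
    subst hN
    have hn : n ≠ 0 := by
      rintro rfl
      exact hne.elim finZeroElim
    have : M = 0 := by
      ext v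
      have : v = 0 := by
        funext i; exact Subsingleton.elim _ _
      rw [this]
      exact M.map_coord_zero (⟨0, Nat.pos_of_ne_zero hn⟩) rfl
    simp [this, hn]
  refine ContinuousMultilinearMap.opNorm_le_bound (by positivity) fun v => ?_
  have hv : v = fun s => ∑ i : Fin N, (v s i) • (EuclideanSpace.single i (1 : ℝ) : RN N) := by
    funext s
    ext j
    simp [Finset.sum_apply, Pi.single_apply]
  have hexp : M v = ∑ r : Fin n → Fin N,
      (∏ s, v s (r s)) • M fun s => EuclideanSpace.single (r s) (1 : ℝ) := by
    conv_lhs => rw [hv]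
    rw [ContinuousMultilinearMap.map_sum]
    refine Finset.sum_congr rfl fun r _ => ?_
    rw [ContinuousMultilinearMap.map_smul_univ]
  rw [hexp]
  calc _ ≤ ∑ r : Fin n → Fin N, ‖(∏ s, v s (r s)) • M fun s => EuclideanSpace.single (r s) (1 : ℝ)‖ :=
        norm_sum_le _ _
    _ ≤ ∑ r : Fin n → Fin N, B * ∏ s, ‖v s‖ := by
        refine Finset.sum_le_sum fun r _ => ?_
        rw [norm_smul, mul_comm, norm_prod]
        refine mul_le_mul (hB r) ?_ (by positivity) hB0
        refine Finset.prod_le_prod (fun _ _ => norm_nonneg _) fun s _ => ?_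
        exact PiLp.norm_apply_le (v s) (r s)
    _ = _ := by simp; ring

lemma norm_iteratedFDeriv_le_sum_md {n : ℕ} {f : RN N → F} (hf : ContDiff ℝ ((n : ℕ) : ℕ∞) f)
    (x : RN N) : ‖iteratedFDeriv ℝ n f x‖ ≤ (N : ℝ) ^ n * ∑ α ∈ idxEq N n, ‖md α f x‖ := by
  refine norm_multilinear_le_sum_basis _ fun r => ?_
  obtain ⟨α, hα, h⟩ := iteratedFDeriv_single_eq_md hf r
  rw [h x]
  exact Finset.single_le_sum (f := fun α => ‖md α f x‖) (fun _ _ => norm_nonneg _) hα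

lemma continuous_md {α : Fin N → ℕ} {f : RN N → F} (hf : ContDiff ℝ ((mOrder α : ℕ) : ℕ∞) f) :
    Continuous (md α f) := by
  rw [md_eq_iterDir]
  exact (ContDiff.iterDir (k := 0) (basisWord α) (by rw [length_basisWord]; exact hf)).continuous

lemma HasCompactSupport.iterDir {f : RN N → F} (hf : HasCompactSupport f) (l : List (RN N)) :
    HasCompactSupport (iterDir l f) := by
  induction l with
  | nil => exact hf
  | cons v l ih => exact ih.fderiv_apply ℝ v

lemma bddAbove_norm_md {α : Fin N → ℕ} {f : RN N → F} (hf : ContDiff ℝ ((mOrder α : ℕ) : ℕ∞) f)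
    (hc : HasCompactSupport f) : BddAbove (range fun z => ‖md α f z‖) := by
  have h := (continuous_md hf).bounded_above_of_compact_support
    (by rw [md_eq_iterDir]; exact hc.iterDir _)
  obtain ⟨C, hC⟩ := h
  exact ⟨C, by rintro _ ⟨z, rfl⟩; exact hC z⟩

lemma supDeriv_nonneg (i : ℕ) (f : RN N → ℂ) : 0 ≤ supDeriv i f :=
  Finset.sum_nonneg fun _ _ => Real.iSup_nonneg fun _ => norm_nonneg _

lemma norm_iteratedFDeriv_le_supDeriv {n : ℕ} {f : RN N → ℂ}
    (hf : ContDiff ℝ ((n : ℕ) : ℕ∞) f) (hc : HasCompactSupport f) (x : RN N) :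
    ‖iteratedFDeriv ℝ n f x‖ ≤ (N : ℝ) ^ n * supDeriv n f := by
  refine (norm_iteratedFDeriv_le_sum_md hf x).trans ?_
  gcongr
  refine Finset.sum_le_sum fun α hα => ?_
  exact le_ciSup (f := fun z => ‖md α f z‖)
    (bddAbove_norm_md (by rw [mem_idxEq.1 hα]; exact hf) hc) x

lemma supDeriv_le {n : ℕ} {f : RN N → ℂ} (hf : ContDiff ℝ ((n : ℕ) : ℕ∞) f) {B : ℝ}
    (hB : ∀ x, ‖iteratedFDeriv ℝ n f x‖ ≤ B) : supDeriv n f ≤ (idxEq N n).card * B := by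
  rw [← nsmul_eq_mul]
  refine Finset.sum_le_card_nsmul _ _ _ fun α hα => ?_
  have h := mem_idxEq.1 hα
  subst h
  exact ciSup_le fun x => (norm_md_le hf x).trans (hB x)

end MultiIndex

section ScaledBounds

variable {E F : Type*} [NormedAddCommGroup E] [NormedSpace ℝ E]
  [NormedAddCommGroup F] [NormedSpace ℝ F]

/-- At the point `x` the derivatives of `h` of order at most `n` are bounded by `B`, up to the
scaling natural at length scale `r`. -/
def ScaledBound (n : ℕ) (r B : ℝ) (h : E → F) (x : E) : Prop :=
  ∀ i ≤ n, ‖iteratedFDeriv ℝ i h x‖ ≤ B / r ^ i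

lemma ScaledBound.nonneg {n : ℕ} {r B : ℝ} {h : E → F} {x : E} (hb : ScaledBound n r B h x) :
    0 ≤ B := by
  have := (norm_nonneg _).trans (hb 0 (Nat.zero_le _))
  simpa using this

lemma ScaledBound.norm_le {n : ℕ} {r B : ℝ} {h : E → F} {x : E} (hb : ScaledBound n r B h x) :
    ‖h x‖ ≤ B := by
  simpa using hb 0 (Nat.zero_le _)

lemma ScaledBound.mono {n n' : ℕ} {r B B' : ℝ} (hr : 0 < r) {h : E → F} {x : E}
    (hb : ScaledBound n r B h x) (hn : n' ≤ n) (hB : B ≤ B') : ScaledBound n' r B' h x :=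
  fun i hi => (hb i (hi.trans hn)).trans (by gcongr)

lemma ScaledBound.change_scale {n : ℕ} {r r' B K : ℝ} (hr : 0 < r) (hr' : 0 < r') (hK : 1 ≤ K)
    (hrr : r' ≤ K * r) {h : E → F} {x : E} (hb : ScaledBound n r B h x) :
    ScaledBound n r' (K ^ n * B) h x := by
  intro i hi
  have hB := hb.nonneg
  refine (hb i hi).trans ?_
  rw [div_le_div_iff₀ (by positivity) (by positivity)]
  calc B * r' ^ i ≤ B * (K * r) ^ i := by gcongr
    _ = K ^ i * B * r ^ i := by ring
    _ ≤ K ^ n * B * r ^ i := by gcongr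

lemma ScaledBound.smul {n : ℕ} {r B₁ B₂ : ℝ} (hr : 0 < r) {g : E → ℝ} {h : E → F} {x : E}
    (hg : ContDiff ℝ (n : ℕ∞) g) (hh : ContDiff ℝ (n : ℕ∞) h)
    (hb₁ : ScaledBound n r B₁ g x) (hb₂ : ScaledBound n r B₂ h x) :
    ScaledBound n r (2 ^ n * (B₁ * B₂)) (fun y => g y • h y) x := by
  intro i hi
  have h₁ := hb₁.nonneg
  have h₂ := hb₂.nonneg
  refine (norm_iteratedFDeriv_smul_le hg hh x (n := i) (by exact_mod_cast hi)).trans ?_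
  calc _ ≤ ∑ j ∈ Finset.range (i + 1), (i.choose j : ℝ) * (B₁ * B₂ / r ^ i) := by
        refine Finset.sum_le_sum fun j hj => ?_
        have hj' : j ≤ i := Nat.lt_succ_iff.1 (Finset.mem_range.1 hj)
        rw [mul_assoc]
        gcongr
        calc _ ≤ B₁ / r ^ j * (B₂ / r ^ (i - j)) := by
              gcongr
              · exact hb₁ j (hj'.trans hi)
              · exact hb₂ (i - j) ((Nat.sub_le _ _).trans hi)
          _ = B₁ * B₂ / r ^ i := by
              rw [div_mul_div_comm, ← pow_add, Nat.add_sub_cancel' hj']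
    _ = 2 ^ i * (B₁ * B₂) / r ^ i := by
        rw [← Finset.sum_mul]
        have := Nat.sum_range_choose i
        rw [show ∑ j ∈ Finset.range (i + 1), (i.choose j : ℝ) = 2 ^ i by exact_mod_cast this]
        ring
    _ ≤ _ := by gcongr; exact one_le_two

lemma ScaledBound.mul {n : ℕ} {r B₁ B₂ : ℝ} (hr : 0 < r) {g h : E → ℝ} {x : E}
    (hg : ContDiff ℝ (n : ℕ∞) g) (hh : ContDiff ℝ (n : ℕ∞) h)
    (hb₁ : ScaledBound n r B₁ g x) (hb₂ : ScaledBound n r B₂ h x) :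
    ScaledBound n r (2 ^ n * (B₁ * B₂)) (fun y => g y * h y) x :=
  ScaledBound.smul hr hg hh hb₁ hb₂

lemma ScaledBound.add {n : ℕ} {r B₁ B₂ : ℝ} {g h : E → F} {x : E}
    (hg : ContDiff ℝ (n : ℕ∞) g) (hh : ContDiff ℝ (n : ℕ∞) h)
    (hb₁ : ScaledBound n r B₁ g x) (hb₂ : ScaledBound n r B₂ h x) :
    ScaledBound n r (B₁ + B₂) (fun y => g y + h y) x := by
  intro i hi
  have hi' : ((i : ℕ) : WithTop ℕ∞) ≤ ((n : ℕ∞) : WithTop ℕ∞) := by exact_mod_cast hi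
  have := iteratedFDeriv_add_apply (x := x) ((hg.of_le hi').contDiffAt) ((hh.of_le hi').contDiffAt)
  change ‖iteratedFDeriv ℝ i (g + h) x‖ ≤ _
  rw [this, add_div]
  exact (norm_add_le _ _).trans (add_le_add (hb₁ i hi) (hb₂ i hi))

lemma ScaledBound.const_smul {n : ℕ} {r B : ℝ} {h : E → F} {x : E} (a : ℝ)
    (hh : ContDiff ℝ (n : ℕ∞) h) (hb : ScaledBound n r B h x) :
    ScaledBound n r (|a| * B) (fun y => a • h y) x := by
  intro i hi
  have hi' : ((i : ℕ) : WithTop ℕ∞) ≤ ((n : ℕ∞) : WithTop ℕ∞) := by exact_mod_cast hi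
  have := iteratedFDeriv_const_smul_apply (a := a) ((hh.of_le hi').contDiffAt (x := x))
  change ‖iteratedFDeriv ℝ i (a • h) x‖ ≤ _
  rw [this, norm_smul, mul_div_assoc, Real.norm_eq_abs]
  exact mul_le_mul_of_nonneg_left (hb i hi) (abs_nonneg a)

lemma ScaledBound.neg {n : ℕ} {r B : ℝ} {h : E → F} {x : E}
    (hb : ScaledBound n r B h x) : ScaledBound n r B (fun y => -h y) x := by
  intro i hi
  change ‖iteratedFDeriv ℝ i (-h) x‖ ≤ _
  rw [iteratedFDeriv_neg_apply, norm_neg]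
  exact hb i hi

lemma ScaledBound.sub {n : ℕ} {r B₁ B₂ : ℝ} {g h : E → F} {x : E}
    (hg : ContDiff ℝ (n : ℕ∞) g) (hh : ContDiff ℝ (n : ℕ∞) h)
    (hb₁ : ScaledBound n r B₁ g x) (hb₂ : ScaledBound n r B₂ h x) :
    ScaledBound n r (B₁ + B₂) (fun y => g y - h y) x := by
  simpa only [sub_eq_add_neg] using hb₁.add hg hh.neg hb₂.neg

lemma ScaledBound.const {n : ℕ} {r : ℝ} (hr : 0 < r) (a : F) (x : E) :
    ScaledBound n r ‖a‖ (fun _ => a) x := by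
  intro i _
  rcases Nat.eq_zero_or_pos i with rfl | hi
  · simp
  · rw [iteratedFDeriv_const_of_ne hi.ne']
    simp only [Pi.zero_apply, norm_zero]
    positivity

lemma ScaledBound.of_notMem_tsupport {n : ℕ} {r B : ℝ} (hr : 0 < r) (hB : 0 ≤ B) {h : E → F} {x : E}
    (hx : x ∉ tsupport h) : ScaledBound n r B h x := by
  intro i _
  have : iteratedFDeriv ℝ i h x = 0 := by
    by_contra hne
    exact hx (support_iteratedFDeriv_subset i hne)
  rw [this, norm_zero]
  positivity

lemma ScaledBound.sum {ι : Type*} (s : Finset ι) {n : ℕ} {r : ℝ} (hr : 0 < r) {B : ι → ℝ}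
    {h : ι → E → F} {x : E} (hh : ∀ a ∈ s, ContDiff ℝ (n : ℕ∞) (h a))
    (hb : ∀ a ∈ s, ScaledBound n r (B a) (h a) x) :
    ScaledBound n r (∑ a ∈ s, B a) (fun y => ∑ a ∈ s, h a y) x := by
  classical
  induction s using Finset.induction_on with
  | empty => simpa using ScaledBound.const hr (0 : F) x
  | insert a s ha ih =>
    simp only [Finset.sum_insert ha]
    refine ScaledBound.add (hh a (Finset.mem_insert_self _ _)) ?_
      (hb a (Finset.mem_insert_self _ _)) (ih (fun b hb' => hh b (Finset.mem_insert_of_mem hb'))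
      fun b hb' => hb b (Finset.mem_insert_of_mem hb'))
    exact ContDiff.sum fun b hb' => hh b (Finset.mem_insert_of_mem hb')

lemma ScaledBound.rescale {n : ℕ} {r B : ℝ} (hr : 0 < r) {h : E → F} (x₀ x : E)
    (hh : ContDiff ℝ (n : ℕ∞) h)
    (hb : ∀ i ≤ n, ‖iteratedFDeriv ℝ i h (r⁻¹ • (x - x₀))‖ ≤ B) :
    ScaledBound n r B (fun y => h (r⁻¹ • (y - x₀))) x := by
  intro i hi
  have hi' : ((i : ℕ) : WithTop ℕ∞) ≤ ((n : ℕ∞) : WithTop ℕ∞) := by exact_mod_cast hi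
  rw [iteratedFDeriv_comp_sub (f := fun y => h (r⁻¹ • y)) i x₀ x,
    iteratedFDeriv_comp_const_smul r⁻¹ (hh.of_le hi'), norm_smul, norm_pow, norm_inv,
    Real.norm_of_nonneg hr.le, inv_pow, mul_comm, ← div_eq_mul_inv]
  gcongr
  exact hb i hi

/-- Functions whose derivatives of order less than `i` vanish at `x₀` are controlled by their
derivative of order `i`. -/
lemma norm_iteratedFDeriv_le_of_vanishing {i : ℕ} {h : E → F} (hh : ContDiff ℝ (i : ℕ∞) h) {x₀ : E}
    (h0 : ∀ j < i, iteratedFDeriv ℝ j h x₀ = 0) {M : ℝ}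
    (hM : ∀ x, ‖iteratedFDeriv ℝ i h x‖ ≤ M) {j : ℕ} (hj : j ≤ i) (x : E) :
    ‖iteratedFDeriv ℝ j h x‖ ≤ ‖x - x₀‖ ^ (i - j) * M := by
  have hM0 : 0 ≤ M := (norm_nonneg _).trans (hM x₀)
  obtain ⟨k, rfl⟩ := Nat.exists_eq_add_of_le hj
  rw [Nat.add_sub_cancel_left]
  clear hj
  induction k generalizing j x with
  | zero => simpa using hM x
  | succ k ih =>
    have hd : Differentiable ℝ (iteratedFDeriv ℝ j h) :=
      hh.differentiable_iteratedFDeriv (by norm_cast; omega)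
    have hbound : ∀ y ∈ closedBall x₀ ‖x - x₀‖,
        ‖fderiv ℝ (iteratedFDeriv ℝ j h) y‖ ≤ ‖x - x₀‖ ^ k * M := by
      intro y hy
      rw [norm_fderiv_iteratedFDeriv]
      have e : j + 1 + k = j + (k + 1) := by ring
      refine (ih (j := j + 1) (x := y) (by rw [e]; exact hh) (by rw [e]; exact h0)
        (by rw [e]; exact hM)).trans ?_
      gcongr
      simpa [dist_eq_norm] using hy
    have := (convex_closedBall x₀ ‖x - x₀‖).norm_image_sub_le_of_norm_fderiv_le
      (fun y _ => hd y) hbound (mem_closedBall_self (norm_nonneg _))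
      (by simp [dist_eq_norm] : x ∈ closedBall x₀ ‖x - x₀‖)
    rw [h0 j (by omega), sub_zero] at this
    refine this.trans (le_of_eq (by ring))

lemma exists_taylor_polynomial (i : ℕ) {f : E → F} (hf : ContDiff ℝ (i : ℕ∞) f) (x₀ : E) :
    ∃ T : E → F, ContDiff ℝ (⊤ : ℕ∞) T ∧ (∀ x, iteratedFDeriv ℝ i T x = 0) ∧
      ∀ j < i, iteratedFDeriv ℝ j (fun x => f x - T x) x₀ = 0 := by
  induction i generalizing f with
  | zero => exact ⟨0, contDiff_const, fun x => by ext; simp, fun j hj => by omega⟩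
  | succ i ih =>
    have hfi : ContDiff ℝ (i : ℕ∞) f := hf.of_le (by exact_mod_cast Nat.le_succ i)
    set M : ContinuousMultilinearMap ℝ (fun _ : Fin i => E) F :=
      ((i.factorial : ℝ)⁻¹) • iteratedFDeriv ℝ i f x₀ with hM
    set q : E → F := fun y => M fun _ => y with hq
    have hqs : ContDiff ℝ (⊤ : ℕ∞) q :=
      M.contDiff.comp (contDiff_pi.2 fun _ => contDiff_id)
    have hqd : ∀ y, iteratedFDeriv ℝ i q y = iteratedFDeriv ℝ i f x₀ := by
      intro y
      ext v
      rw [hq, ContinuousMultilinearMap.iteratedFDeriv_comp_diagonal]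
      simp only [hM, smul_apply]
      simp_rw [iteratedFDeriv_comp_perm_of_contDiff hfi x₀ v]
      rw [Finset.sum_const, Finset.card_univ, Fintype.card_perm, Fintype.card_fin,
        ← Nat.cast_smul_eq_nsmul ℝ, smul_smul,
        mul_inv_cancel₀ (by exact_mod_cast i.factorial_ne_zero), one_smul]
    set p : E → F := fun x => q (x - x₀) with hp
    have hps : ContDiff ℝ (⊤ : ℕ∞) p := hqs.comp (contDiff_id.sub contDiff_const)
    have hpd : ∀ y, iteratedFDeriv ℝ i p y = iteratedFDeriv ℝ i f x₀ := by
      intro y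
      rw [hp, iteratedFDeriv_comp_sub, hqd]
    have hle : ∀ k : ℕ, ((k : ℕ∞) : WithTop ℕ∞) ≤ ((⊤ : ℕ∞) : WithTop ℕ∞) := fun k => by
      exact_mod_cast le_top
    obtain ⟨T, hTs, hT0, hTd⟩ := ih (f := fun x => f x - p x) (hfi.sub (hps.of_le (hle i)))
    refine ⟨fun x => p x + T x, hps.add hTs, fun x => ?_, fun j hj => ?_⟩
    · have h1 : iteratedFDeriv ℝ i (fun x => p x + T x) = fun _ => iteratedFDeriv ℝ i f x₀ := by
        funext y
        have := iteratedFDeriv_add_apply (x := y) (i := i) ((hps.of_le (hle i)).contDiffAt)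
          ((hTs.of_le (hle i)).contDiffAt)
        change iteratedFDeriv ℝ i (p + T) y = _
        rw [this, hpd, hT0, add_zero]
      ext v
      rw [iteratedFDeriv_succ_apply_left, h1]
      simp
    · have e : (fun x => f x - (p x + T x)) = fun x => (f x - p x) - T x := by
        funext x; abel
      rw [e]
      rcases Nat.lt_succ_iff_lt_or_eq.1 hj with h | rfl
      · exact hTd j h
      · have h1 := iteratedFDeriv_sub_apply (x := x₀) (i := j) (f := f - p) (g := T)
          ((hfi.sub (hps.of_le (hle j))).contDiffAt) ((hTs.of_le (hle j)).contDiffAt)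
        have h2 := iteratedFDeriv_sub_apply (x := x₀) (i := j) (f := f) (g := p)
          hfi.contDiffAt ((hps.of_le (hle j)).contDiffAt)
        change iteratedFDeriv ℝ j ((f - p) - T) x₀ = 0
        rw [h1, h2, hpd, hT0, sub_self, sub_zero]

lemma iteratedFDeriv_eq_zero_of_le {i n : ℕ} (hin : i ≤ n) {T : E → F}
    (h : ∀ x, iteratedFDeriv ℝ i T x = 0) (x : E) : iteratedFDeriv ℝ n T x = 0 := by
  induction n, hin using Nat.le_induction generalizing x with
  | base => exact h x
  | succ n _ ih =>
    have h1 : iteratedFDeriv ℝ n T = fun _ => 0 := funext ih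
    ext v
    rw [iteratedFDeriv_succ_apply_left, h1]
    simp

end ScaledBounds

section Polynomials

/-- Real polynomials of degree less than `n`, described as the smooth functions whose derivative of
order `n` vanishes. -/
def polySpace (N n : ℕ) : Submodule ℝ (RN N → ℝ) where
  carrier := {T | ContDiff ℝ (⊤ : ℕ∞) T ∧ ∀ x, iteratedFDeriv ℝ n T x = 0}
  zero_mem' := ⟨contDiff_const, fun x => by
    change iteratedFDeriv ℝ n (fun _ => (0 : ℝ)) x = 0
    simp⟩
  add_mem' {S T} hS hT := ⟨hS.1.add hT.1, fun x => by
    rw [iteratedFDeriv_add_apply ((hS.1.of_le (by exact_mod_cast le_top)).contDiffAt)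
      ((hT.1.of_le (by exact_mod_cast le_top)).contDiffAt), hS.2, hT.2, add_zero]⟩
  smul_mem' a T hT := ⟨hT.1.const_smul a, fun x => by
    rw [iteratedFDeriv_const_smul_apply ((hT.1.of_le (by exact_mod_cast le_top)).contDiffAt),
      hT.2, smul_zero]⟩

lemma eq_zero_of_mem_polySpace {n : ℕ} {T : RN N → ℝ} (hT : T ∈ polySpace N n) {x₀ : RN N}
    (h0 : ∀ j < n, iteratedFDeriv ℝ j T x₀ = 0) : T = 0 := by
  funext x
  have := norm_iteratedFDeriv_le_of_vanishing (hT.1.of_le (by exact_mod_cast le_top)) h0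
    (M := 0) (fun x => by rw [hT.2, norm_zero]) (Nat.zero_le n) x
  simpa using this

lemma ContinuousMultilinearMap.eq_zero_of_basis {n : ℕ} {F : Type*} [NormedAddCommGroup F]
    [NormedSpace ℝ F] (M : ContinuousMultilinearMap ℝ (fun _ : Fin n => RN N) F)
    (h : ∀ r : Fin n → Fin N, (M fun s => EuclideanSpace.single (r s) (1 : ℝ)) = 0) : M = 0 := by
  have := norm_multilinear_le_sum_basis M (B := 0) fun r => by rw [h r, norm_zero]
  simpa using this

instance (N n : ℕ) : FiniteDimensional ℝ (polySpace N n) := by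
  let Φ : polySpace N n →ₗ[ℝ] ((j : Fin n) → (Fin j → Fin N) → ℝ) :=
    { toFun := fun T j r =>
        iteratedFDeriv ℝ j T.1 0 fun s => EuclideanSpace.single (r s) (1 : ℝ)
      map_add' := fun S T => by
        funext j r
        have := iteratedFDeriv_add_apply (𝕜 := ℝ) (x := (0 : RN N)) (i := j)
          ((S.2.1.of_le (by exact_mod_cast le_top)).contDiffAt)
          ((T.2.1.of_le (by exact_mod_cast le_top)).contDiffAt)
        simp [this]
      map_smul' := fun a T => by
        funext j r
        have := iteratedFDeriv_const_smul_apply (𝕜 := ℝ) (x := (0 : RN N)) (i := j) (a := a)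
          ((T.2.1.of_le (by exact_mod_cast le_top)).contDiffAt)
        simp [this] }
  refine FiniteDimensional.of_injective Φ ?_
  rw [← LinearMap.ker_eq_bot, LinearMap.ker_eq_bot']
  intro T hT
  refine Subtype.ext (eq_zero_of_mem_polySpace T.2 (x₀ := 0) fun j hj => ?_)
  exact ContinuousMultilinearMap.eq_zero_of_basis _ fun r => congrFun (congrFun hT ⟨j, hj⟩) r

lemma mul_mem_polySpace {a b n : ℕ} {S T : RN N → ℝ} (hS : S ∈ polySpace N (a + 1))
    (hT : T ∈ polySpace N (b + 1)) (hn : n = a + b + 1) :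
    (fun x => S x * T x) ∈ polySpace N n := by
  refine ⟨hS.1.mul hT.1, fun x => ?_⟩
  rw [← norm_le_zero_iff]
  refine (norm_iteratedFDeriv_mul_le hS.1 hT.1 x (n := n) (by exact_mod_cast le_top)).trans ?_
  refine le_of_eq (Finset.sum_eq_zero fun i hi => ?_)
  have hi' := Finset.mem_range.1 hi
  by_cases h : a + 1 ≤ i
  · rw [iteratedFDeriv_eq_zero_of_le h hS.2]; simp
  · rw [iteratedFDeriv_eq_zero_of_le (by omega : b + 1 ≤ n - i) hT.2]; simp

lemma polySpace_mono {a b : ℕ} (h : a ≤ b) : polySpace N a ≤ polySpace N b :=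
  fun _ hT => ⟨hT.1, iteratedFDeriv_eq_zero_of_le h hT.2⟩

lemma const_mem_polySpace (a : ℝ) : (fun _ => a) ∈ polySpace N 1 :=
  ⟨contDiff_const, fun x => by rw [iteratedFDeriv_const_of_ne one_ne_zero]; rfl⟩

lemma coord_mem_polySpace (i : Fin N) : (fun x : RN N => x i) ∈ polySpace N 2 := by
  refine ⟨(EuclideanSpace.proj (𝕜 := ℝ) i).contDiff, fun x => ?_⟩
  ext v
  have h1 : (fderiv ℝ fun x : RN N => x i) = fun _ => EuclideanSpace.proj (𝕜 := ℝ) i := by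
    funext y
    exact (EuclideanSpace.proj (𝕜 := ℝ) i).fderiv
  rw [iteratedFDeriv_two_apply, h1]
  simp

lemma monomial_mem_polySpace (γ : Fin N → ℕ) {n : ℕ} (h : mOrder γ < n) :
    (fun x : RN N => ∏ i, x i ^ γ i) ∈ polySpace N n := by
  refine polySpace_mono (Nat.succ_le_of_lt h) ?_
  have hpow : ∀ (i : Fin N) (k : ℕ), (fun x : RN N => x i ^ k) ∈ polySpace N (k + 1) := by
    intro i k
    induction k with
    | zero => simpa using const_mem_polySpace (1 : ℝ)
    | succ k ih =>
      simp only [pow_succ]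
      exact mul_mem_polySpace ih (coord_mem_polySpace i) (by ring)
  have : ∀ s : Finset (Fin N), (fun x : RN N => ∏ i ∈ s, x i ^ γ i) ∈
      polySpace N ((∑ i ∈ s, γ i) + 1) := by
    intro s
    induction s using Finset.induction_on with
    | empty => simpa using const_mem_polySpace (1 : ℝ)
    | insert i s hi ih =>
      simp only [Finset.prod_insert hi, Finset.sum_insert hi]
      exact mul_mem_polySpace (hpow i _) ih rfl
  exact this Finset.univ

/-- Precomposition with an affine homothety preserves polynomials. -/
lemma comp_affine_mem_polySpace {n : ℕ} {T : RN N → ℝ} (hT : T ∈ polySpace N n) (a : ℝ)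
    (b : RN N) : (fun x => T (a • x + b)) ∈ polySpace N n := by
  have h1 : ContDiff ℝ (⊤ : ℕ∞) fun x => T (x + b) := hT.1.comp (contDiff_id.add contDiff_const)
  refine ⟨hT.1.comp (by fun_prop : ContDiff ℝ (⊤ : ℕ∞) fun x : RN N => a • x + b), fun x => ?_⟩
  rw [iteratedFDeriv_comp_const_smul (f := fun x => T (x + b)) a
    (h1.of_le (by exact_mod_cast le_top))]
  simp only [iteratedFDeriv_comp_add_right, hT.2, smul_zero]

/-- A bump function supported in the closed unit ball. -/
def unitBump (N : ℕ) : ContDiffBump (0 : RN N) where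
  rIn := 1 / 2
  rOut := 1
  rIn_pos := by norm_num
  rIn_lt_rOut := by norm_num

lemma exists_dual_polynomials (N n : ℕ) :
    ∃ (d : ℕ) (e ρ : Fin d → RN N → ℝ), (∀ a, e a ∈ polySpace N n) ∧
      (∀ a, ContDiff ℝ (⊤ : ℕ∞) (ρ a)) ∧ (∀ a, tsupport (ρ a) ⊆ closedBall 0 1) ∧
      (∀ a b, ∫ x, ρ a x * e b x = if a = b then 1 else 0) ∧
      ∀ T ∈ polySpace N n, ∀ x, T x = ∑ a, (∫ y, ρ a y * T y) * e a x := by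
  classical
  set θ := unitBump N with hθ
  have hθs : ContDiff ℝ (⊤ : ℕ∞) (θ : RN N → ℝ) := θ.contDiff
  have hint : ∀ S T : polySpace N n, Integrable fun x => θ x * (S.1 x * T.1 x) := by
    intro S T
    refine Continuous.integrable_of_hasCompactSupport ?_ θ.hasCompactSupport.mul_right
    exact hθs.continuous.mul (S.2.1.continuous.mul T.2.1.continuous)
  let B : LinearMap.BilinForm ℝ (polySpace N n) := LinearMap.mk₂ ℝ
    (fun S T => ∫ x, θ x * (S.1 x * T.1 x))
    (fun S S' T => by
      rw [← integral_add (hint S T) (hint S' T)]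
      congr 1; funext x; simp; ring)
    (fun a S T => by
      rw [smul_eq_mul, ← integral_const_mul]
      congr 1; funext x; simp; ring)
    (fun S T T' => by
      rw [← integral_add (hint S T) (hint S T')]
      congr 1; funext x; simp; ring)
    (fun a S T => by
      rw [smul_eq_mul, ← integral_const_mul]
      congr 1; funext x; simp; ring)
  have hBapp : ∀ S T, B S T = ∫ x, θ x * (S.1 x * T.1 x) := fun S T => rfl
  have hdef : ∀ S, B S S = 0 → S = 0 := by
    intro S hS
    rw [hBapp] at hS
    have hnn : 0 ≤ fun x => θ x * (S.1 x * S.1 x) := fun x =>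
      mul_nonneg θ.nonneg (mul_self_nonneg _)
    have hz : (fun x => θ x * (S.1 x * S.1 x)) = 0 := by
      have := (integral_eq_zero_iff_of_nonneg hnn (hint S S)).1 hS
      exact (Continuous.ae_eq_iff_eq volume
        (hθs.continuous.mul (S.2.1.continuous.mul S.2.1.continuous)) continuous_const).1 this
    have hzero : ∀ x ∈ ball (0 : RN N) 1, S.1 x = 0 := by
      intro x hx
      have h1 := congrFun hz x
      have h2 : 0 < θ x := θ.pos_of_mem_ball hx
      simpa [h2.ne'] using h1
    refine Subtype.ext (eq_zero_of_mem_polySpace S.2 (x₀ := 0) fun j _ => ?_)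
    have hev : S.1 =ᶠ[𝓝 (0 : RN N)] fun _ => (0 : ℝ) := by
      filter_upwards [ball_mem_nhds (0 : RN N) one_pos] with x hx using hzero x hx
    rw [hev.iteratedFDeriv ℝ j |>.eq_of_nhds]
    simp
  have hsymm : ∀ S T, B S T = B T S := by
    intro S T
    rw [hBapp, hBapp]
    congr 1; funext x; ring
  have hB : B.Nondegenerate :=
    ⟨fun S hS => hdef S (hS S), fun S hS => hdef S (hS S)⟩
  let b := Module.finBasis ℝ (polySpace N n)
  let b' := B.dualBasis hB b
  have hdual : ∀ i j, B (b' i) (b j) = if i = j then 1 else 0 := fun i j => by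
    rw [LinearMap.BilinForm.apply_dualBasis_left]; simp [eq_comm]
  have hmul : ∀ a (T : polySpace N n), ∫ y, θ y * (b' a).1 y * T.1 y = B (b' a) T := by
    intro a T
    rw [hBapp]; congr 1; funext x; ring
  refine ⟨_, fun a => (b a).1, fun a x => θ x * (b' a).1 x, fun a => (b a).2,
    fun a => hθs.mul (b' a).2.1, fun a => ?_, fun i j => ?_, fun T hT x => ?_⟩
  · refine (tsupport_mul_subset_left).trans ?_
    rw [θ.tsupport_eq]
    exact subset_rfl
  · rw [hmul, hdual]
  · have hT' : (⟨T, hT⟩ : polySpace N n) = ∑ a, B (b' a) ⟨T, hT⟩ • b a := by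
      conv_lhs => rw [← b.sum_repr ⟨T, hT⟩]
      refine Finset.sum_congr rfl fun a _ => ?_
      congr 1
      conv_rhs => rw [← b.sum_repr ⟨T, hT⟩]
      simp only [map_sum, map_smul, hdual]
      simp
    have := congrArg (fun S : polySpace N n => S.1 x) hT'
    simp only at this
    rw [this]
    simp only [Submodule.coe_sum, Submodule.coe_smul, Finset.sum_apply, Pi.smul_apply, smul_eq_mul]
    refine Finset.sum_congr rfl fun a _ => ?_
    rw [← hmul a ⟨T, hT⟩]

end Polynomials

section GrandMaximal

lemma le_grandMax_of_scaledBound {L : ℕ} {f : RN N → ℂ} {x : RN N} {s B : ℝ} (hs : 0 < s)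
    (hB : 0 < B) {ψ : RN N → ℝ} (hψ : ContDiff ℝ (⊤ : ℕ∞) ψ) (hsupp : tsupport ψ ⊆ ball x s)
    (hb : ∀ z, ScaledBound L s B ψ z) :
    ENNReal.ofReal ‖∫ z, ψ z • f z‖ ≤ ENNReal.ofReal (B * s ^ N) * grandMax L f x := by
  have hc : HasCompactSupport ψ :=
    HasCompactSupport.of_support_subset_isCompact (isCompact_closedBall x s)
      ((subset_tsupport ψ).trans (hsupp.trans ball_subset_closedBall))
  set a : ℝ := (B * s ^ N)⁻¹ with ha
  have ha0 : 0 < a := by positivity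
  have hmem : (fun z => a * ψ z) ∈ calF L x s := by
    refine ⟨contDiff_const.mul hψ, hc.mul_left, (tsupport_mul_subset_right).trans hsupp, ?_⟩
    intro α hα z
    have hsm : ContDiff ℝ (⊤ : ℕ∞) fun z => a * ψ z := contDiff_const.mul hψ
    rw [← Real.norm_eq_abs]
    refine (norm_md_le (hsm.of_le (by exact_mod_cast le_top)) z).trans ?_
    have h1 := (hb z).const_smul a (hψ.of_le (by exact_mod_cast le_top)) _ hα
    refine h1.trans (le_of_eq ?_)
    rw [abs_of_pos ha0, ha, pow_add]
    field_simp
  have hle : ENNReal.ofReal ‖∫ z, (a * ψ z) • f z‖ ≤ grandMax L f x := by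
    unfold grandMax
    exact le_iSup₂_of_le s hs (le_iSup₂_of_le (fun z => a * ψ z) hmem le_rfl)
  have hint : ∫ z, (a * ψ z) • f z = a • ∫ z, ψ z • f z := by
    rw [← integral_smul]
    congr 1; funext z; rw [smul_smul]
  rw [hint, norm_smul, Real.norm_of_nonneg ha0.le, ENNReal.ofReal_mul ha0.le] at hle
  calc ENNReal.ofReal ‖∫ z, ψ z • f z‖
      = ENNReal.ofReal (B * s ^ N) * (ENNReal.ofReal a * ENNReal.ofReal ‖∫ z, ψ z • f z‖) := by
        rw [← mul_assoc, ← ENNReal.ofReal_mul (by positivity), ha,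
          mul_inv_cancel₀ (by positivity), ENNReal.ofReal_one, one_mul]
    _ ≤ _ := by gcongr

/-- The functional `f` is bounded by `A` on averages at scale `r` around `x₀`. -/
def TestBound (L : ℕ) (x₀ : RN N) (r A : ℝ) (f : RN N → ℂ) : Prop :=
  ∀ (ψ : RN N → ℝ) (B : ℝ), ContDiff ℝ (⊤ : ℕ∞) ψ → tsupport ψ ⊆ closedBall x₀ (10 * r) →
    (∀ z, ScaledBound L r B ψ z) → ‖∫ z, ψ z • f z‖ ≤ B * r ^ N * A

lemma testBound_of_grandMax_le {L : ℕ} {f : RN N → ℂ} {x x₀ : RN N} {r Λ α : ℝ} (hr : 0 < r)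
    (hΛ : 0 ≤ Λ) (hx : dist x₀ x ≤ Λ * r) (hα : 0 ≤ α)
    (hM : grandMax L f x ≤ ENNReal.ofReal α) :
    TestBound L x₀ r ((Λ + 11) ^ (L + N) * α) f := by
  intro ψ B hψ hsupp hb
  have hB : 0 ≤ B := (hb x).nonneg
  rcases hB.eq_or_lt with rfl | hB
  · have : ψ = 0 := by
      funext z
      simpa using (hb z).norm_le
    simp [this]
  have hs : 0 < (Λ + 11) * r := by positivity
  have h1 := le_grandMax_of_scaledBound (L := L) (f := f) (x := x) (s := (Λ + 11) * r)
    (B := (Λ + 11) ^ L * B) hs (by positivity) hψ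
    (hsupp.trans (closedBall_subset_ball' (by nlinarith)))
    (fun z => (hb z).change_scale hr hs (by linarith) le_rfl)
  have h2 := h1.trans (mul_le_mul_right hM _)
  rw [← ENNReal.ofReal_mul (by positivity), ENNReal.ofReal_le_ofReal_iff (by positivity)] at h2
  refine h2.trans (le_of_eq ?_)
  rw [mul_pow, pow_add]; ring

end GrandMaximal

section LocalProjection

/-- A finite system of polynomials spanning those of degree less than `n`, with smooth dual
functions supported in the unit ball. -/
structure DualSystem (N n : ℕ) where
  d : ℕ
  e : Fin d → RN N → ℝ
  ρ : Fin d → RN N → ℝ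
  e_mem : ∀ a, e a ∈ polySpace N n
  ρ_smooth : ∀ a, ContDiff ℝ (⊤ : ℕ∞) (ρ a)
  ρ_supp : ∀ a, tsupport (ρ a) ⊆ closedBall 0 1
  dual : ∀ a b, ∫ x, ρ a x * e b x = if a = b then 1 else 0
  expand : ∀ T ∈ polySpace N n, ∀ x, T x = ∑ a, (∫ y, ρ a y * T y) * e a x

lemma integral_rescale {F : Type*} [NormedAddCommGroup F] [NormedSpace ℝ F] {r : ℝ} (hr : 0 < r)
    (x₀ : RN N) (h : RN N → F) : ∫ x, h (r⁻¹ • (x - x₀)) = r ^ N • ∫ x, h x := by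
  rw [integral_sub_right_eq_self (fun x => h (r⁻¹ • x)) x₀, Measure.integral_comp_smul]
  rw [finrank_euclideanSpace_fin, inv_pow, inv_inv, abs_of_pos (by positivity)]

lemma smooth_rescale {F : Type*} [NormedAddCommGroup F] [NormedSpace ℝ F] (r : ℝ)
    (x₀ : RN N) {h : RN N → F} (hh : ContDiff ℝ (⊤ : ℕ∞) h) :
    ContDiff ℝ (⊤ : ℕ∞) fun x => h (r⁻¹ • (x - x₀)) :=
  hh.comp (by fun_prop : ContDiff ℝ (⊤ : ℕ∞) fun x : RN N => r⁻¹ • (x - x₀))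

lemma tsupport_rescale {F : Type*} [NormedAddCommGroup F] {r R : ℝ} (hr : 0 < r)
    (x₀ : RN N) {h : RN N → F} (hh : tsupport h ⊆ closedBall 0 R) :
    tsupport (fun x => h (r⁻¹ • (x - x₀))) ⊆ closedBall x₀ (R * r) := by
  refine closure_minimal (fun x hx => ?_) isClosed_closedBall
  have h1 := hh (subset_tsupport h (show h (r⁻¹ • (x - x₀)) ≠ 0 from hx))
  rw [mem_closedBall_zero_iff, norm_smul, norm_inv, Real.norm_of_nonneg hr.le] at h1
  rw [mem_closedBall, dist_eq_norm]
  rwa [inv_mul_le_iff₀ hr, mul_comm] at h1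

lemma exists_bound_iteratedFDeriv_on {F : Type*} [NormedAddCommGroup F] [NormedSpace ℝ F]
    {h : RN N → F} (hh : ContDiff ℝ (⊤ : ℕ∞) h) (n : ℕ) {K : Set (RN N)} (hK : IsCompact K) :
    ∃ C, 0 < C ∧ ∀ i ≤ n, ∀ x ∈ K, ‖iteratedFDeriv ℝ i h x‖ ≤ C := by
  have h1 : ∀ i : ℕ, ∃ C, ∀ x ∈ K, ‖iteratedFDeriv ℝ i h x‖ ≤ C := fun i =>
    hK.exists_bound_of_continuousOn
      ((hh.continuous_iteratedFDeriv (m := i) (by exact_mod_cast le_top)).continuousOn)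
  choose C hC using h1
  refine ⟨1 + ∑ i ∈ Finset.range (n + 1), |C i|, by positivity, fun i hi x hx => ?_⟩
  have := Finset.single_le_sum (f := fun i => |C i|) (fun _ _ => abs_nonneg _)
    (Finset.mem_range.2 (Nat.lt_succ_of_le hi))
  have h2 := (hC i x hx).trans (le_abs_self _)
  linarith

lemma exists_bound_iteratedFDeriv {F : Type*} [NormedAddCommGroup F] [NormedSpace ℝ F]
    {h : RN N → F} (hh : ContDiff ℝ (⊤ : ℕ∞) h) (n : ℕ) {R : ℝ} (hR : tsupport h ⊆ closedBall 0 R) :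
    ∃ C, 0 < C ∧ ∀ i ≤ n, ∀ x, ‖iteratedFDeriv ℝ i h x‖ ≤ C := by
  obtain ⟨C, hC0, hC⟩ := exists_bound_iteratedFDeriv_on hh n (isCompact_closedBall (0 : RN N) R)
  refine ⟨C, hC0, fun i hi x => ?_⟩
  by_cases hx : x ∈ tsupport h
  · exact hC i hi x (hR hx)
  · have : iteratedFDeriv ℝ i h x = 0 := by
      by_contra hne
      exact hx (support_iteratedFDeriv_subset i hne)
    rw [this, norm_zero]; exact hC0.le

namespace DualSystem

variable {n : ℕ} (S : DualSystem N n)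

/-- The spanning polynomials at scale `r` around `x₀`. -/
def es (x₀ : RN N) (r : ℝ) (a : Fin S.d) (x : RN N) : ℝ := S.e a (r⁻¹ • (x - x₀))

/-- The dual functions at scale `r` around `x₀`. -/
def ρs (x₀ : RN N) (r : ℝ) (a : Fin S.d) (x : RN N) : ℝ := (r ^ N)⁻¹ * S.ρ a (r⁻¹ • (x - x₀))

variable (x₀ : RN N) {r : ℝ}

lemma es_smooth (r : ℝ) (a : Fin S.d) : ContDiff ℝ (⊤ : ℕ∞) (S.es x₀ r a) :=
  smooth_rescale r x₀ (S.e_mem a).1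

lemma ρs_smooth (r : ℝ) (a : Fin S.d) : ContDiff ℝ (⊤ : ℕ∞) (S.ρs x₀ r a) :=
  contDiff_const.mul (smooth_rescale r x₀ (S.ρ_smooth a))

lemma ρs_supp (hr : 0 < r) (a : Fin S.d) : tsupport (S.ρs x₀ r a) ⊆ closedBall x₀ r := by
  refine (tsupport_mul_subset_right).trans ?_
  simpa using tsupport_rescale hr x₀ (S.ρ_supp a)

lemma ρs_compact (hr : 0 < r) (a : Fin S.d) : HasCompactSupport (S.ρs x₀ r a) :=
  HasCompactSupport.of_support_subset_isCompact (isCompact_closedBall x₀ r)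
    ((subset_tsupport _).trans (S.ρs_supp x₀ hr a))

lemma expand_scaled (hr : 0 < r) {T : RN N → ℝ} (hT : T ∈ polySpace N n) (x : RN N) :
    T x = ∑ a, (∫ y, S.ρs x₀ r a y * T y) * S.es x₀ r a x := by
  have h := S.expand _ (comp_affine_mem_polySpace hT r x₀) (r⁻¹ • (x - x₀))
  have hsimp : ∀ y : RN N, r • (r⁻¹ • (y - x₀)) + x₀ = y := fun y => by
    rw [smul_smul, mul_inv_cancel₀ hr.ne', one_smul, sub_add_cancel]
  rw [hsimp] at h
  rw [h]
  refine Finset.sum_congr rfl fun a _ => ?_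
  congr 1
  have h2 := integral_rescale hr x₀ fun y => S.ρ a y * T (r • y + x₀)
  simp only [hsimp] at h2
  have e : ∀ y, S.ρs x₀ r a y * T y = (r ^ N)⁻¹ * (S.ρ a (r⁻¹ • (y - x₀)) * T y) := fun y => by
    simp only [ρs]; ring
  simp_rw [e]
  rw [integral_const_mul, h2, smul_eq_mul, ← mul_assoc, inv_mul_cancel₀ (by positivity), one_mul]

variable {F : Type*} [NormedAddCommGroup F] [NormedSpace ℝ F]

/-- The projection onto polynomials of degree less than `n` at scale `r` around `x₀`. -/
def proj (x₀ : RN N) (r : ℝ) (f : RN N → F) (x : RN N) : F :=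
  ∑ a, S.es x₀ r a x • ∫ y, S.ρs x₀ r a y • f y

lemma integrable_ρs_smul (hr : 0 < r) (a : Fin S.d) {f : RN N → F} (hf : Continuous f) :
    Integrable fun y => S.ρs x₀ r a y • f y :=
  ((S.ρs_smooth x₀ r a).continuous.smul hf).integrable_of_hasCompactSupport
    (S.ρs_compact x₀ hr a).smul_right

lemma proj_smooth (r : ℝ) (f : RN N → F) : ContDiff ℝ (⊤ : ℕ∞) (S.proj x₀ r f) :=
  ContDiff.sum fun a _ => (S.es_smooth x₀ r a).smul contDiff_const

lemma proj_sub (hr : 0 < r) {f g : RN N → F} (hf : Continuous f) (hg : Continuous g) (x : RN N) :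
    S.proj x₀ r (fun y => f y - g y) x = S.proj x₀ r f x - S.proj x₀ r g x := by
  simp only [proj, smul_sub]
  rw [← Finset.sum_sub_distrib]
  refine Finset.sum_congr rfl fun a _ => ?_
  rw [← smul_sub, integral_sub (S.integrable_ρs_smul x₀ hr a hf) (S.integrable_ρs_smul x₀ hr a hg)]

lemma proj_eq_self [CompleteSpace F] (hr : 0 < r) {T : RN N → F} (hT : ContDiff ℝ (⊤ : ℕ∞) T)
    (h0 : ∀ x, iteratedFDeriv ℝ n T x = 0) (x : RN N) : S.proj x₀ r T x = T x := by
  refine (SeparatingDual.eq_iff_forall_dual_eq (R := ℝ)).2 fun ℓ => ?_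
  have hmem : (fun y => ℓ (T y)) ∈ polySpace N n := by
    refine ⟨ℓ.contDiff.comp hT, fun y => ?_⟩
    have := ℓ.iteratedFDeriv_comp_left (x := y) hT.contDiffAt (i := n) (by exact_mod_cast le_top)
    change iteratedFDeriv ℝ n (ℓ ∘ T) y = 0
    rw [this, h0]
    ext v; simp
  rw [S.expand_scaled x₀ hr hmem x]
  simp only [proj, map_sum, map_smul, smul_eq_mul]
  refine Finset.sum_congr rfl fun a _ => ?_
  rw [← ℓ.integral_comp_comm (S.integrable_ρs_smul x₀ hr a hT.continuous), mul_comm]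
  simp

/-- Uniform bounds for the scaled systems. -/
structure BoundedBy (C : ℝ) : Prop where
  one_le : 1 ≤ C
  es_bound : ∀ (x₀ : RN N) (r : ℝ), 0 < r → ∀ a, ∀ x ∈ closedBall x₀ (10 * r),
    ScaledBound n r C (S.es x₀ r a) x
  ρs_bound : ∀ (x₀ : RN N) (r : ℝ), 0 < r → ∀ a x, ScaledBound n r (C / r ^ N) (S.ρs x₀ r a) x
  ρs_int : ∀ (x₀ : RN N) (r : ℝ), 0 < r → ∀ a, ∫ y, ‖S.ρs x₀ r a y‖ ≤ C

lemma exists_boundedBy : ∃ C, S.BoundedBy C := by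
  choose C₁ hC₁0 hC₁ using fun a => exists_bound_iteratedFDeriv_on (S.e_mem a).1 n
    (isCompact_closedBall (0 : RN N) 10)
  choose C₂ hC₂0 hC₂ using fun a => exists_bound_iteratedFDeriv (S.ρ_smooth a) n (S.ρ_supp a)
  set C₃ : Fin S.d → ℝ := fun a => ∫ y, ‖S.ρ a y‖
  have hC₃0 : ∀ a, 0 ≤ C₃ a := fun a => integral_nonneg fun _ => norm_nonneg _
  set C : ℝ := 1 + ∑ a, (C₁ a + C₂ a + C₃ a) with hC
  have hle : ∀ a, C₁ a + C₂ a + C₃ a ≤ C := fun a => by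
    have := Finset.single_le_sum (f := fun a => C₁ a + C₂ a + C₃ a)
      (fun a _ => by have := hC₁0 a; have := hC₂0 a; have := hC₃0 a; positivity) (Finset.mem_univ a)
    linarith
  refine ⟨C, ?_, fun x₀ r hr a x hx => ?_, fun x₀ r hr a x => ?_, fun x₀ r hr a => ?_⟩
  · have : 0 ≤ ∑ a, (C₁ a + C₂ a + C₃ a) :=
      Finset.sum_nonneg fun a _ => by have := hC₁0 a; have := hC₂0 a; have := hC₃0 a; positivity
    linarith
  · refine ScaledBound.rescale hr x₀ x ((S.e_mem a).1.of_le (by exact_mod_cast le_top))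
      fun i hi => (hC₁ a i hi _ ?_).trans ?_
    · rw [mem_closedBall, dist_eq_norm] at hx
      rw [mem_closedBall_zero_iff, norm_smul, norm_inv, Real.norm_of_nonneg hr.le,
        inv_mul_le_iff₀ hr]
      linarith
    · have := hle a; have := hC₂0 a; have := hC₃0 a; linarith
  · have h1 : ScaledBound n r (C₂ a) (fun x => S.ρ a (r⁻¹ • (x - x₀))) x :=
      ScaledBound.rescale hr x₀ x ((S.ρ_smooth a).of_le (by exact_mod_cast le_top))
        fun i hi => hC₂ a i hi _
    have h2 := h1.const_smul (r ^ N)⁻¹ ((smooth_rescale r x₀ (S.ρ_smooth a)).of_le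
      (by exact_mod_cast le_top))
    refine h2.mono hr le_rfl ?_
    rw [abs_of_pos (by positivity), div_eq_inv_mul]
    have := hle a; have := hC₁0 a; have := hC₃0 a
    gcongr; linarith
  · have h2 := integral_rescale hr x₀ fun y => ‖S.ρ a y‖
    have e : ∀ y, ‖S.ρs x₀ r a y‖ = (r ^ N)⁻¹ * ‖S.ρ a (r⁻¹ • (y - x₀))‖ := fun y => by
      rw [ρs, norm_mul, Real.norm_of_nonneg (by positivity : (0 : ℝ) ≤ (r ^ N)⁻¹)]
    simp_rw [e]
    rw [integral_const_mul, h2, smul_eq_mul, ← mul_assoc, inv_mul_cancel₀ (by positivity), one_mul]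
    have := hle a; have := hC₁0 a; have := hC₂0 a
    change C₃ a ≤ C
    linarith

end DualSystem

end LocalProjection

section Atoms

variable {n : ℕ} {F : Type*} [NormedAddCommGroup F] [NormedSpace ℝ F]

lemma norm_integral_le_of_eq_zero_off_ball {x₀ : RN N} {r A : ℝ} (hr : 0 < r) {h : RN N → F}
    (hA : ∀ x, ‖h x‖ ≤ A) (h0 : ∀ x, x ∉ closedBall x₀ (10 * r) → h x = 0) :
    ‖∫ x, h x‖ ≤ A * (volume.real (closedBall (0 : RN N) 10) * r ^ N) := by
  rw [← setIntegral_eq_integral_of_forall_compl_eq_zero h0]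
  refine (norm_setIntegral_le_of_norm_le_const measure_closedBall_lt_top fun x _ => hA x).trans
    (le_of_eq ?_)
  rw [Measure.addHaar_real_closedBall volume x₀ (by positivity),
    Measure.addHaar_real_closedBall volume (0 : RN N) (by norm_num), finrank_euclideanSpace_fin]
  ring

/-- A smooth cutoff adapted to the ball of radius `10 * r` around `x₀`. -/
structure IsCutoff (n : ℕ) (H : ℝ) (x₀ : RN N) (r : ℝ) (η : RN N → ℝ) : Prop where
  smooth : ContDiff ℝ (⊤ : ℕ∞) η
  supp : tsupport η ⊆ closedBall x₀ (10 * r)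
  bound : ∀ x, ScaledBound n r H η x

namespace IsCutoff

variable {H : ℝ} {x₀ : RN N} {r : ℝ} {η : RN N → ℝ}

lemma compact (hη : IsCutoff n H x₀ r η) : HasCompactSupport η :=
  HasCompactSupport.of_support_subset_isCompact (isCompact_closedBall x₀ (10 * r))
    ((subset_tsupport _).trans hη.supp)

lemma eq_zero (hη : IsCutoff n H x₀ r η) {x : RN N} (hx : x ∉ closedBall x₀ (10 * r)) : η x = 0 :=
  image_eq_zero_of_notMem_tsupport fun h => hx (hη.supp h)

lemma nonneg (hη : IsCutoff n H x₀ r η) : 0 ≤ H := (hη.bound x₀).nonneg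

lemma of_le (hη : IsCutoff n H x₀ r η) (i : ℕ) : ContDiff ℝ (i : ℕ∞) η :=
  hη.smooth.of_le (by exact_mod_cast le_top)

end IsCutoff

namespace DualSystem

variable (S : DualSystem N n) {C : ℝ} {x₀ : RN N} {r : ℝ}

lemma proj_bound (hC : S.BoundedBy C) (hr : 0 < r) {f : RN N → F} {A : ℝ}
    (hA : ∀ a, ‖∫ y, S.ρs x₀ r a y • f y‖ ≤ A) {x : RN N} (hx : x ∈ closedBall x₀ (10 * r)) :
    ScaledBound n r (S.d * (2 ^ n * (C * A))) (S.proj x₀ r f) x := by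
  have h := ScaledBound.sum (Finset.univ : Finset (Fin S.d)) (n := n) hr
    (B := fun a => 2 ^ n * (C * ‖∫ y, S.ρs x₀ r a y • f y‖))
    (h := fun a x => S.es x₀ r a x • ∫ y, S.ρs x₀ r a y • f y) (x := x)
    (fun a _ => ((S.es_smooth x₀ r a).smul contDiff_const).of_le (by exact_mod_cast le_top))
    (fun a _ => ScaledBound.smul hr ((S.es_smooth x₀ r a).of_le (by exact_mod_cast le_top))
      contDiff_const (hC.es_bound x₀ r hr a x hx) (ScaledBound.const hr _ x))
  refine h.mono hr le_rfl ?_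
  calc _ ≤ ∑ _a : Fin S.d, 2 ^ n * (C * A) := by
        have := hC.one_le
        gcongr with a
        exact hA a
    _ = _ := by simp

lemma residual_bound [CompleteSpace F] (hC : S.BoundedBy C) (hr : 0 < r) {i : ℕ} (hi : i ≤ n)
    {f : RN N → F} (hf : ContDiff ℝ (i : ℕ∞) f) {M : ℝ}
    (hM : ∀ x, ‖iteratedFDeriv ℝ i f x‖ ≤ M) {x : RN N} (hx : x ∈ closedBall x₀ (10 * r)) :
    ScaledBound i r ((10 ^ n + S.d * (2 ^ n * (C * C))) * (r ^ i * M))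
      (fun y => f y - S.proj x₀ r f y) x := by
  have hC1 := hC.one_le
  have hM0 : 0 ≤ M := (norm_nonneg _).trans (hM x₀)
  obtain ⟨T, hTs, hT0, hTd⟩ := exists_taylor_polynomial i hf x₀
  have hTi : ContDiff ℝ (i : ℕ∞) T := hTs.of_le (by exact_mod_cast le_top)
  set G : RN N → F := fun y => f y - T y with hG
  have hGs : ContDiff ℝ (i : ℕ∞) G := hf.sub hTi
  have hGM : ∀ y, ‖iteratedFDeriv ℝ i G y‖ ≤ M := fun y => by
    have := iteratedFDeriv_sub_apply (x := y) (i := i) (f := f) (g := T) hf.contDiffAt hTi.contDiffAt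
    change ‖iteratedFDeriv ℝ i (f - T) y‖ ≤ M
    rw [this, hT0, sub_zero]; exact hM y
  have hGv : ∀ j ≤ i, ∀ y, ‖iteratedFDeriv ℝ j G y‖ ≤ ‖y - x₀‖ ^ (i - j) * M := fun j hj y =>
    norm_iteratedFDeriv_le_of_vanishing hGs hTd hGM hj y
  have hres : (fun y => f y - S.proj x₀ r f y) = fun y => G y - S.proj x₀ r G y := by
    funext y
    rw [hG, S.proj_sub x₀ hr hf.continuous hTs.continuous,
      S.proj_eq_self x₀ hr hTs (iteratedFDeriv_eq_zero_of_le hi hT0)]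
    exact (sub_sub_sub_cancel_right _ _ _).symm
  have hcoef : ∀ a, ‖∫ y, S.ρs x₀ r a y • G y‖ ≤ C * (r ^ i * M) := by
    intro a
    refine (norm_integral_le_of_norm_le (g := fun y => ‖S.ρs x₀ r a y‖ * (r ^ i * M)) ?_
      (Eventually.of_forall fun y => ?_)).trans ?_
    · exact ((S.ρs_smooth x₀ r a).continuous.norm.integrable_of_hasCompactSupport
        (S.ρs_compact x₀ hr a).norm).mul_const _
    · rw [norm_smul]
      by_cases hy : y ∈ closedBall x₀ r
      · gcongr
        have h1 := hGv 0 (Nat.zero_le _) y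
        rw [norm_iteratedFDeriv_zero, Nat.sub_zero] at h1
        refine h1.trans ?_
        gcongr
        simpa [dist_eq_norm] using hy
      · rw [image_eq_zero_of_notMem_tsupport fun h => hy (S.ρs_supp x₀ hr a h)]
        simp
    · rw [integral_mul_const]
      gcongr
      exact hC.ρs_int x₀ r hr a
  rw [hres, add_mul]
  refine ScaledBound.sub hGs ((S.proj_smooth x₀ r G).of_le (by exact_mod_cast le_top)) ?_ ?_
  · intro j hj
    refine (hGv j hj x).trans ?_
    have hxr : ‖x - x₀‖ ≤ 10 * r := by simpa [dist_eq_norm] using hx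
    rw [le_div_iff₀ (by positivity)]
    calc ‖x - x₀‖ ^ (i - j) * M * r ^ j ≤ (10 * r) ^ (i - j) * M * r ^ j := by gcongr
      _ = 10 ^ (i - j) * (r ^ (i - j) * r ^ j * M) := by ring
      _ = 10 ^ (i - j) * (r ^ i * M) := by rw [← pow_add, Nat.sub_add_cancel hj]
      _ ≤ 10 ^ n * (r ^ i * M) := by
        gcongr
        · norm_num
        · omega
  · refine (S.proj_bound hC hr hcoef hx).mono hr hi (le_of_eq (by ring))

/-- The localized residual `η (f - proj f)`. -/
def localized (x₀ : RN N) (r : ℝ) (η : RN N → ℝ) (f : RN N → F) (x : RN N) : F :=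
  η x • (f x - S.proj x₀ r f x)

/-- The localized residual, corrected so that its moments of order less than `n` vanish. -/
def atom (x₀ : RN N) (r : ℝ) (η : RN N → ℝ) (f : RN N → F) (x : RN N) : F :=
  S.localized x₀ r η f x - ∑ a, S.ρs x₀ r a x • ∫ y, S.es x₀ r a y • S.localized x₀ r η f y

variable {H : ℝ} {η : RN N → ℝ}

lemma localized_contDiff (hη : IsCutoff n H x₀ r η) {i : ℕ} {f : RN N → F}
    (hf : ContDiff ℝ (i : ℕ∞) f) : ContDiff ℝ (i : ℕ∞) (S.localized x₀ r η f) :=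
  (hη.of_le i).smul (hf.sub ((S.proj_smooth x₀ r f).of_le (by exact_mod_cast le_top)))

lemma localized_tsupport (hη : IsCutoff n H x₀ r η) (f : RN N → F) :
    tsupport (S.localized x₀ r η f) ⊆ closedBall x₀ (10 * r) :=
  (tsupport_smul_subset_left _ _).trans hη.supp

lemma localized_eq_zero (hη : IsCutoff n H x₀ r η) (f : RN N → F) {x : RN N}
    (hx : x ∉ closedBall x₀ (10 * r)) : S.localized x₀ r η f x = 0 := by
  rw [localized, hη.eq_zero hx, zero_smul]

lemma localized_continuous (hη : IsCutoff n H x₀ r η) {f : RN N → F} (hf : Continuous f) :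
    Continuous (S.localized x₀ r η f) :=
  hη.smooth.continuous.smul (hf.sub (S.proj_smooth x₀ r f).continuous)

lemma localized_compact (hη : IsCutoff n H x₀ r η) (f : RN N → F) :
    HasCompactSupport (S.localized x₀ r η f) :=
  hη.compact.smul_right

lemma atom_continuous (hη : IsCutoff n H x₀ r η) {f : RN N → F} (hf : Continuous f) :
    Continuous (S.atom x₀ r η f) :=
  (S.localized_continuous hη hf).sub (continuous_finsetSum _ fun a _ =>
    (S.ρs_smooth x₀ r a).continuous.smul continuous_const)

lemma atom_contDiff (hη : IsCutoff n H x₀ r η) {i : ℕ} {f : RN N → F}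
    (hf : ContDiff ℝ (i : ℕ∞) f) : ContDiff ℝ (i : ℕ∞) (S.atom x₀ r η f) :=
  (S.localized_contDiff hη hf).sub (ContDiff.sum fun a _ =>
    ((S.ρs_smooth x₀ r a).of_le (by exact_mod_cast le_top)).smul contDiff_const)

lemma atom_eq_zero (hr : 0 < r) (hη : IsCutoff n H x₀ r η) (f : RN N → F) {x : RN N}
    (hx : x ∉ closedBall x₀ (10 * r)) : S.atom x₀ r η f x = 0 := by
  rw [atom, S.localized_eq_zero hη f hx, zero_sub, neg_eq_zero]
  refine Finset.sum_eq_zero fun a _ => ?_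
  rw [image_eq_zero_of_notMem_tsupport (f := S.ρs x₀ r a) fun h =>
    hx (closedBall_subset_closedBall (by linarith) (S.ρs_supp x₀ hr a h)), zero_smul]

lemma atom_tsupport (hr : 0 < r) (hη : IsCutoff n H x₀ r η) (f : RN N → F) :
    tsupport (S.atom x₀ r η f) ⊆ closedBall x₀ (10 * r) := by
  refine closure_minimal (fun x hx => ?_) isClosed_closedBall
  by_contra h
  exact hx (S.atom_eq_zero hr hη f h)

lemma localized_bound [CompleteSpace F] (hC : S.BoundedBy C) (hr : 0 < r)
    (hη : IsCutoff n H x₀ r η) {i : ℕ} (hi : i ≤ n)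
    {f : RN N → F} (hf : ContDiff ℝ (i : ℕ∞) f) {M : ℝ}
    (hM : ∀ x, ‖iteratedFDeriv ℝ i f x‖ ≤ M) (x : RN N) :
    ScaledBound i r (2 ^ n * (H * ((10 ^ n + S.d * (2 ^ n * (C * C))) * (r ^ i * M))))
      (S.localized x₀ r η f) x := by
  have hC1 := hC.one_le
  have hM0 : 0 ≤ M := (norm_nonneg _).trans (hM x₀)
  have hH := hη.nonneg
  by_cases hx : x ∈ closedBall x₀ (10 * r)
  · refine (ScaledBound.smul hr (hη.of_le i)
      (hf.sub ((S.proj_smooth x₀ r f).of_le (by exact_mod_cast le_top)))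
      ((hη.bound x).mono hr hi le_rfl) (S.residual_bound hC hr hi hf hM hx)).mono hr le_rfl ?_
    gcongr
    norm_num
  · exact ScaledBound.of_notMem_tsupport hr (by positivity)
      fun h => hx (S.localized_tsupport hη f h)

lemma norm_integral_es_smul_le (hC : S.BoundedBy C) (hr : 0 < r) {w : RN N → F} {A : ℝ}
    (hA : ∀ x, ‖w x‖ ≤ A) (h0 : ∀ x, x ∉ closedBall x₀ (10 * r) → w x = 0) (a : Fin S.d) :
    ‖∫ y, S.es x₀ r a y • w y‖ ≤
      C * A * (volume.real (closedBall (0 : RN N) 10) * r ^ N) := by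
  have hC1 := hC.one_le
  have hA0 : 0 ≤ A := (norm_nonneg _).trans (hA x₀)
  refine norm_integral_le_of_eq_zero_off_ball (x₀ := x₀) hr (fun x => ?_) fun x hx => by
    rw [h0 x hx, smul_zero]
  by_cases hx : x ∈ closedBall x₀ (10 * r)
  · rw [norm_smul]
    have := (hC.es_bound x₀ r hr a x hx).norm_le
    gcongr
    exact hA x
  · rw [h0 x hx, smul_zero, norm_zero]; positivity

lemma exists_atom_bound [CompleteSpace F] (hC : S.BoundedBy C) (hH : 0 ≤ H) :
    ∃ K, 0 ≤ K ∧ ∀ (x₀ : RN N) (r : ℝ) (η : RN N → ℝ), 0 < r → IsCutoff n H x₀ r η →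
      ∀ i ≤ n, ∀ f : RN N → F, ContDiff ℝ (i : ℕ∞) f → ∀ M,
        (∀ x, ‖iteratedFDeriv ℝ i f x‖ ≤ M) →
        ∀ x, ScaledBound i r (K * (r ^ i * M)) (S.atom x₀ r η f) x := by
  have hC1 := hC.one_le
  set D : ℝ := 2 ^ n * (H * (10 ^ n + S.d * (2 ^ n * (C * C)))) with hD
  set V : ℝ := volume.real (closedBall (0 : RN N) 10) with hV
  refine ⟨D + S.d * (2 ^ n * (C * (C * D * V))), by positivity,
    fun x₀ r η hr hη i hi f hf M hM x => ?_⟩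
  have hM0 : 0 ≤ M := (norm_nonneg _).trans (hM x₀)
  have hw : ∀ y, ScaledBound i r (D * (r ^ i * M)) (S.localized x₀ r η f) y := fun y =>
    (S.localized_bound hC hr hη hi hf hM y).mono hr le_rfl (le_of_eq (by rw [hD]; ring))
  rw [add_mul]
  refine ScaledBound.sub (S.localized_contDiff hη hf) (ContDiff.sum fun a _ =>
    ((S.ρs_smooth x₀ r a).of_le (by exact_mod_cast le_top)).smul contDiff_const) (hw x) ?_
  have h := ScaledBound.sum (Finset.univ : Finset (Fin S.d)) (n := i) hr
    (B := fun a => 2 ^ i * (C / r ^ N * ‖∫ y, S.es x₀ r a y • S.localized x₀ r η f y‖))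
    (h := fun a x => S.ρs x₀ r a x • ∫ y, S.es x₀ r a y • S.localized x₀ r η f y) (x := x)
    (fun a _ => ((S.ρs_smooth x₀ r a).smul contDiff_const).of_le (by exact_mod_cast le_top))
    (fun a _ => ScaledBound.smul hr ((S.ρs_smooth x₀ r a).of_le (by exact_mod_cast le_top))
      contDiff_const ((hC.ρs_bound x₀ r hr a x).mono hr hi le_rfl) (ScaledBound.const hr _ x))
  refine h.mono hr le_rfl ?_
  calc _ ≤ ∑ _a : Fin S.d, 2 ^ n * (C / r ^ N * (C * (D * (r ^ i * M)) * (V * r ^ N))) := by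
        gcongr with a
        · norm_num
        · exact S.norm_integral_es_smul_le hC hr (fun y => (hw y).norm_le)
            (fun y hy => S.localized_eq_zero hη f hy) a
    _ = _ := by
        simp only [Finset.sum_const, Finset.card_univ, Fintype.card_fin, nsmul_eq_mul]
        field_simp

lemma integral_smul_atom [CompleteSpace F] (hr : 0 < r) (hη : IsCutoff n H x₀ r η) {f : RN N → F}
    (hf : Continuous f) {u : RN N → ℝ} (hu : Continuous u) :
    ∫ x, u x • S.atom x₀ r η f x =
      (∫ x, u x • S.localized x₀ r η f x) -
        ∑ a, (∫ x, S.ρs x₀ r a x * u x) • ∫ y, S.es x₀ r a y • S.localized x₀ r η f y := by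
  have hw := S.localized_continuous hη hf
  have hint : ∀ a, Integrable fun x =>
      (S.ρs x₀ r a x * u x) • ∫ y, S.es x₀ r a y • S.localized x₀ r η f y := fun a =>
    (S.integrable_ρs_smul x₀ hr a hu).smul_const _
  have e : ∀ x, u x • S.atom x₀ r η f x = u x • S.localized x₀ r η f x -
      ∑ a, (S.ρs x₀ r a x * u x) • ∫ y, S.es x₀ r a y • S.localized x₀ r η f y := by
    intro x
    rw [atom, smul_sub, Finset.smul_sum]
    congr 1
    refine Finset.sum_congr rfl fun a _ => ?_
    rw [smul_smul, mul_comm]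
  simp_rw [e]
  rw [integral_sub, integral_finsetSum]
  · congr 1
    refine Finset.sum_congr rfl fun a _ => ?_
    rw [integral_smul_const]
  · exact fun a _ => hint a
  · exact (hu.smul hw).integrable_of_hasCompactSupport (S.localized_compact hη f).smul_left
  · exact integrable_finsetSum _ fun a _ => hint a

lemma integral_poly_smul_atom [CompleteSpace F] (hr : 0 < r) (hη : IsCutoff n H x₀ r η)
    {f : RN N → F} (hf : Continuous f) {T : RN N → ℝ} (hT : T ∈ polySpace N n) :
    ∫ x, T x • S.atom x₀ r η f x = 0 := by
  have hw := S.localized_continuous hη hf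
  rw [S.integral_smul_atom hr hη hf hT.1.continuous, sub_eq_zero]
  have e : ∀ x, T x • S.localized x₀ r η f x = ∑ a, (∫ y, S.ρs x₀ r a y * T y) •
      (S.es x₀ r a x • S.localized x₀ r η f x) := by
    intro x
    conv_lhs => rw [S.expand_scaled x₀ hr hT x, Finset.sum_smul]
    refine Finset.sum_congr rfl fun a _ => ?_
    rw [smul_smul]
  simp_rw [e]
  rw [integral_finsetSum]
  · simp_rw [integral_smul]
  · intro a _
    exact (((S.es_smooth x₀ r a).continuous.smul hw).integrable_of_hasCompactSupport
      (S.localized_compact hη f).smul_left).smul _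

/-- Duality: testing the atom of `f` against `u` amounts to testing `f` against the localized
residual of `u`. -/
lemma integral_smul_atom_eq_dual [CompleteSpace F] (hr : 0 < r) (hη : IsCutoff n H x₀ r η)
    {f : RN N → F} (hf : Continuous f) {u : RN N → ℝ} (hu : Continuous u) :
    ∫ x, u x • S.atom x₀ r η f x = (∫ x, S.localized x₀ r η u x • f x) -
      ∑ a, (∫ x, S.es x₀ r a x • S.localized x₀ r η u x) • ∫ y, S.ρs x₀ r a y • f y := by
  have hw := S.localized_continuous hη hf
  have hwu := S.localized_continuous hη hu
  have hi1 : Integrable fun x => u x • S.localized x₀ r η f x :=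
    (hu.smul hw).integrable_of_hasCompactSupport (S.localized_compact hη f).smul_left
  have hi2 : Integrable fun x => S.localized x₀ r η u x • f x :=
    (hwu.smul hf).integrable_of_hasCompactSupport (S.localized_compact hη u).smul_right
  have hi3 : ∀ a, Integrable fun x => (∫ y, S.ρs x₀ r a y * u y) •
      (S.es x₀ r a x • S.localized x₀ r η f x) := fun a =>
    (((S.es_smooth x₀ r a).continuous.smul hw).integrable_of_hasCompactSupport
      (S.localized_compact hη f).smul_left).smul _
  have hi4 : ∀ a, Integrable fun x => (S.es x₀ r a x • S.localized x₀ r η u x) •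
      ∫ y, S.ρs x₀ r a y • f y := fun a =>
    (((S.es_smooth x₀ r a).continuous.smul hwu).integrable_of_hasCompactSupport
      (S.localized_compact hη u).smul_left).smul_const _
  rw [S.integral_smul_atom hr hη hf hu]
  rw [Finset.sum_congr rfl fun a _ => (integral_smul _ _).symm,
    Finset.sum_congr rfl fun a _ => (integral_smul_const _ _).symm,
    ← integral_finsetSum _ fun a _ => hi3 a, ← integral_finsetSum _ fun a _ => hi4 a,
    ← integral_sub hi1 (integrable_finsetSum _ fun a _ => hi3 a),
    ← integral_sub hi2 (integrable_finsetSum _ fun a _ => hi4 a)]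
  congr 1
  funext x
  have e1 : ∑ a, (∫ y, S.ρs x₀ r a y * u y) • (S.es x₀ r a x • S.localized x₀ r η f x) =
      S.proj x₀ r u x • S.localized x₀ r η f x := by
    rw [proj, Finset.sum_smul]
    refine Finset.sum_congr rfl fun a _ => ?_
    rw [smul_smul, smul_eq_mul, mul_comm]
    rfl
  have e2 : ∑ a, (S.es x₀ r a x • S.localized x₀ r η u x) • ∫ y, S.ρs x₀ r a y • f y =
      S.localized x₀ r η u x • S.proj x₀ r f x := by
    rw [proj, Finset.smul_sum]
    refine Finset.sum_congr rfl fun a _ => ?_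
    rw [smul_smul, smul_eq_mul, mul_comm]
  rw [e1, e2, ← sub_smul, ← smul_sub]
  simp only [localized, smul_smul, smul_eq_mul]
  rw [mul_comm]

lemma TestBound.norm_ρs_le {L : ℕ} (hL : L ≤ n) (hC : S.BoundedBy C) (hr : 0 < r)
    {f : RN N → ℂ} {A : ℝ} (hA : TestBound L x₀ r A f) (a : Fin S.d) :
    ‖∫ y, S.ρs x₀ r a y • f y‖ ≤ C * A := by
  have := hA (S.ρs x₀ r a) (C / r ^ N) (S.ρs_smooth x₀ r a)
    ((S.ρs_supp x₀ hr a).trans (closedBall_subset_closedBall (by linarith)))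
    fun z => (hC.ρs_bound x₀ r hr a z).mono hr hL le_rfl
  rwa [div_mul_cancel₀ _ (by positivity)] at this

lemma exists_error_bound {L : ℕ} (hL : L ≤ n) (hC : S.BoundedBy C) (hH : 0 ≤ H) :
    ∃ K, 0 ≤ K ∧ ∀ (x₀ : RN N) (r : ℝ) (η : RN N → ℝ), 0 < r → IsCutoff n H x₀ r η →
      ∀ (f : RN N → ℂ) (A : ℝ), Continuous f → 0 ≤ A → TestBound L x₀ r A f →
        ∀ x, ‖η x • f x - S.atom x₀ r η f x‖ ≤ K * A := by
  have hC1 := hC.one_le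
  set P : ℝ := S.d * (2 ^ n * (C * C)) with hP
  set V : ℝ := volume.real (closedBall (0 : RN N) 10) with hV
  refine ⟨H * P + S.d * (C * (2 ^ n * (C * H) + C * (H * P) * V)), by positivity,
    fun x₀ r η hr hη f A hf hA0 hA x => ?_⟩
  have hproj : ∀ y ∈ closedBall x₀ (10 * r), ‖S.proj x₀ r f y‖ ≤ P * A := fun y hy =>
    (S.proj_bound hC hr (TestBound.norm_ρs_le S hL hC hr hA) hy).norm_le.trans
      (le_of_eq (by rw [hP]; ring))
  have hηproj : ∀ y, ‖η y • S.proj x₀ r f y‖ ≤ H * P * A := by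
    intro y
    by_cases hy : y ∈ closedBall x₀ (10 * r)
    · rw [norm_smul, mul_assoc]
      exact mul_le_mul (hη.bound y).norm_le (hproj y hy) (norm_nonneg _) hH
    · rw [hη.eq_zero hy, zero_smul, norm_zero]; positivity
  have hprojc := (S.proj_smooth x₀ r f).continuous
  have hηc := hη.smooth.continuous
  have hmom : ∀ a, ‖∫ y, S.es x₀ r a y • S.localized x₀ r η f y‖ ≤
      (2 ^ n * (C * H) + C * (H * P) * V) * r ^ N * A := by
    intro a
    have hec := (S.es_smooth x₀ r a).continuous
    have e : ∀ y, S.es x₀ r a y • S.localized x₀ r η f y =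
        (S.es x₀ r a y * η y) • f y - S.es x₀ r a y • (η y • S.proj x₀ r f y) := fun y => by
      rw [localized, smul_sub, smul_sub, smul_smul]
    simp_rw [e]
    have hi1 : Integrable fun y => (S.es x₀ r a y * η y) • f y :=
      ((hec.mul hηc).smul hf).integrable_of_hasCompactSupport hη.compact.mul_left.smul_right
    have hi2 : Integrable fun y => S.es x₀ r a y • (η y • S.proj x₀ r f y) :=
      (hec.smul (hηc.smul hprojc)).integrable_of_hasCompactSupport
        hη.compact.smul_right.smul_left
    rw [integral_sub hi1 hi2]
    have h1 := hA (fun y => S.es x₀ r a y * η y) (2 ^ n * (C * H))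
      ((S.es_smooth x₀ r a).mul hη.smooth) (tsupport_mul_subset_right.trans hη.supp) fun z => by
        by_cases hz : z ∈ closedBall x₀ (10 * r)
        · exact (ScaledBound.mul hr ((S.es_smooth x₀ r a).of_le (by exact_mod_cast le_top))
            (hη.of_le n) (hC.es_bound x₀ r hr a z hz) (hη.bound z)).mono hr hL le_rfl
        · exact ScaledBound.of_notMem_tsupport hr (by positivity)
            fun h => hz (hη.supp (tsupport_mul_subset_right h))
    have h2 := S.norm_integral_es_smul_le hC hr hηproj
      (fun y hy => by rw [hη.eq_zero hy, zero_smul]) a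
    refine (norm_sub_le _ _).trans ((add_le_add h1 h2).trans (le_of_eq ?_))
    rw [← hV]; ring
  have e : η x • f x - S.atom x₀ r η f x = η x • S.proj x₀ r f x +
      ∑ a, S.ρs x₀ r a x • ∫ y, S.es x₀ r a y • S.localized x₀ r η f y := by
    rw [atom, localized, smul_sub]; abel
  rw [e, add_mul]
  refine (norm_add_le _ _).trans (add_le_add (hηproj x) ?_)
  calc _ ≤ ∑ a, ‖S.ρs x₀ r a x • ∫ y, S.es x₀ r a y • S.localized x₀ r η f y‖ := norm_sum_le _ _
    _ ≤ ∑ _a : Fin S.d, C / r ^ N * ((2 ^ n * (C * H) + C * (H * P) * V) * r ^ N * A) := by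
        refine Finset.sum_le_sum fun a _ => ?_
        rw [norm_smul]
        exact mul_le_mul (hC.ρs_bound x₀ r hr a x).norm_le (hmom a) (norm_nonneg _) (by positivity)
    _ = _ := by
        simp only [Finset.sum_const, Finset.card_univ, Fintype.card_fin, nsmul_eq_mul]
        field_simp

lemma exists_test_atom_bound {L : ℕ} (hL : L ≤ n) (hC : S.BoundedBy C) (hH : 0 ≤ H) :
    ∃ K, 0 ≤ K ∧ ∀ (x₀ : RN N) (r : ℝ) (η : RN N → ℝ), 0 < r → IsCutoff n H x₀ r η →
      ∀ (f : RN N → ℂ) (A : ℝ), Continuous f → TestBound L x₀ r A f →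
        ∀ (u : RN N → ℝ) (M : ℝ), ContDiff ℝ (⊤ : ℕ∞) u → (∀ x, ‖iteratedFDeriv ℝ n u x‖ ≤ M) →
          ‖∫ x, u x • S.atom x₀ r η f x‖ ≤ K * (r ^ (N + n) * M * A) := by
  have hC1 := hC.one_le
  set D : ℝ := 2 ^ n * (H * (10 ^ n + S.d * (2 ^ n * (C * C)))) with hD
  set V : ℝ := volume.real (closedBall (0 : RN N) 10) with hV
  refine ⟨D + S.d * (C * D * V * C), by positivity, fun x₀ r η hr hη f A hf hA u M hu hM => ?_⟩
  have hM0 : 0 ≤ M := (norm_nonneg _).trans (hM x₀)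
  have hun : ContDiff ℝ (n : ℕ∞) u := hu.of_le (by exact_mod_cast le_top)
  have hw : ∀ y, ScaledBound n r (D * (r ^ n * M)) (S.localized x₀ r η u) y := fun y =>
    (S.localized_bound hC hr hη le_rfl hun hM y).mono hr le_rfl (le_of_eq (by rw [hD]; ring))
  rw [S.integral_smul_atom_eq_dual hr hη hf hu.continuous, add_mul]
  refine (norm_sub_le _ _).trans (add_le_add ?_ ?_)
  · refine (hA _ _ ?_ (S.localized_tsupport hη u) fun z => (hw z).mono hr hL le_rfl).trans
      (le_of_eq (by rw [pow_add]; ring))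
    exact hη.smooth.smul (hu.sub (S.proj_smooth x₀ r u))
  · calc _ ≤ ∑ a, ‖(∫ x, S.es x₀ r a x • S.localized x₀ r η u x) • ∫ y, S.ρs x₀ r a y • f y‖ :=
          norm_sum_le _ _
      _ ≤ ∑ _a : Fin S.d, (C * (D * (r ^ n * M)) * (V * r ^ N)) * (C * A) := by
          refine Finset.sum_le_sum fun a _ => ?_
          rw [norm_smul]
          exact mul_le_mul (S.norm_integral_es_smul_le hC hr (fun y => (hw y).norm_le)
            (fun y hy => S.localized_eq_zero hη u hy) a)
            (TestBound.norm_ρs_le S hL hC hr hA a) (norm_nonneg _) (by positivity)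
      _ = _ := by
          simp only [Finset.sum_const, Finset.card_univ, Fintype.card_fin, nsmul_eq_mul]
          rw [pow_add]; ring

end DualSystem

end Atoms

section AtomMaximal

variable {n : ℕ} {φ : RN N → ℝ}

lemma GoodPhi.dil_eq (hφ : GoodPhi φ) (t : ℝ) (x : RN N) :
    (fun y => dil φ t (x - y)) = fun y => (t ^ N)⁻¹ * φ (t⁻¹ • (y - x)) := by
  funext y
  rw [dil, div_eq_inv_mul, hφ.radial (t⁻¹ • (x - y)) (t⁻¹ • (y - x))]
  rw [norm_smul, norm_smul, norm_sub_rev]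

lemma GoodPhi.dil_smooth (hφ : GoodPhi φ) (t : ℝ) (x : RN N) :
    ContDiff ℝ (⊤ : ℕ∞) fun y => dil φ t (x - y) := by
  rw [hφ.dil_eq]
  exact contDiff_const.mul (smooth_rescale t x hφ.smooth)

lemma GoodPhi.dil_tsupport (hφ : GoodPhi φ) {t : ℝ} (ht : 0 < t) (x : RN N) :
    tsupport (fun y => dil φ t (x - y)) ⊆ closedBall x t := by
  rw [hφ.dil_eq]
  refine tsupport_mul_subset_right.trans ?_
  simpa using tsupport_rescale ht x hφ.supp

lemma GoodPhi.dil_nonneg (hφ : GoodPhi φ) {t : ℝ} (ht : 0 < t) (x : RN N) : 0 ≤ dil φ t x :=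
  div_nonneg (hφ.nonneg _) (by positivity)

lemma GoodPhi.dil_compact (hφ : GoodPhi φ) {t : ℝ} (ht : 0 < t) (x : RN N) :
    HasCompactSupport fun y => dil φ t (x - y) :=
  HasCompactSupport.of_support_subset_isCompact (isCompact_closedBall x t)
    ((subset_tsupport _).trans (hφ.dil_tsupport ht x))

lemma GoodPhi.dil_integrable (hφ : GoodPhi φ) {t : ℝ} (ht : 0 < t) (x : RN N) :
    Integrable fun y => dil φ t (x - y) :=
  (hφ.dil_smooth t x).continuous.integrable_of_hasCompactSupport (hφ.dil_compact ht x)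

lemma GoodPhi.integral_dil (hφ : GoodPhi φ) {t : ℝ} (ht : 0 < t) (x : RN N) :
    ∫ y, dil φ t (x - y) = 1 := by
  rw [hφ.dil_eq, integral_const_mul, integral_rescale ht, hφ.int_one, smul_eq_mul, mul_one,
    inv_mul_cancel₀ (by positivity)]

lemma GoodPhi.exists_dil_bound (hφ : GoodPhi φ) (n : ℕ) :
    ∃ C, 1 ≤ C ∧ ∀ (x : RN N) (t : ℝ), 0 < t →
      ∀ z, ScaledBound n t (C / t ^ N) (fun y => dil φ t (x - y)) z := by
  obtain ⟨C, -, hC⟩ := exists_bound_iteratedFDeriv hφ.smooth n hφ.supp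
  refine ⟨max C 1, le_max_right _ _, fun x t ht z => ?_⟩
  rw [hφ.dil_eq]
  have h1 : ScaledBound n t C (fun y => φ (t⁻¹ • (y - x))) z :=
    ScaledBound.rescale ht x z (hφ.smooth.of_le (by exact_mod_cast le_top)) fun i hi => hC i hi _
  have h2 := h1.const_smul (t ^ N)⁻¹ ((smooth_rescale t x hφ.smooth).of_le
    (by exact_mod_cast le_top))
  refine h2.mono ht le_rfl ?_
  rw [abs_of_pos (by positivity), div_eq_inv_mul]
  gcongr
  exact le_max_left _ _

namespace DualSystem

variable (S : DualSystem N n) {C H : ℝ} {L : ℕ}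

lemma exists_convAt_atom_near (hφ : GoodPhi φ) (hL : L ≤ n) (hC : S.BoundedBy C) (hH : 1 ≤ H) :
    ∃ K, 0 ≤ K ∧ ∀ (x₀ : RN N) (r : ℝ) (η : RN N → ℝ), 0 < r → IsCutoff n H x₀ r η →
      ∀ (f : RN N → ℂ) (A : ℝ) (x : RN N), Continuous f → 0 ≤ A → TestBound L x₀ r A f →
        grandMax L f x ≤ ENNReal.ofReal A →
        ∀ t, 0 < t → ‖convAt φ t (S.atom x₀ r η f) x‖ ≤ K * A := by
  obtain ⟨Cφ, hCφ1, hCφ⟩ := hφ.exists_dil_bound n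
  obtain ⟨K₁, hK₁0, hK₁⟩ := S.exists_error_bound hL hC (zero_le_one.trans hH)
  obtain ⟨K₂, hK₂0, hK₂⟩ := S.exists_test_atom_bound hL hC (zero_le_one.trans hH)
  refine ⟨2 ^ n * (2 ^ n * (H * Cφ)) * 2 ^ N + K₁ + K₂ * Cφ, by positivity,
    fun x₀ r η hr hη f A x hf hA0 hA hM t ht => ?_⟩
  have hus := hφ.dil_smooth t x
  rcases le_or_gt r t with hrt | htr
  · have h1 := hK₂ x₀ r η hr hη f A hf hA (fun y => dil φ t (x - y)) (Cφ / t ^ N / t ^ n) hus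
      fun z => hCφ x t ht z n le_rfl
    refine h1.trans ?_
    have h2 : r ^ (N + n) * (Cφ / t ^ N / t ^ n) ≤ Cφ := by
      rw [div_div, ← pow_add, mul_div_assoc', div_le_iff₀ (by positivity), mul_comm]
      gcongr
    calc K₂ * (r ^ (N + n) * (Cφ / t ^ N / t ^ n) * A) ≤ K₂ * (Cφ * A) := by gcongr
      _ ≤ _ := by
        rw [add_mul, mul_assoc K₂]
        exact le_add_of_nonneg_left (by positivity)
  · set u : RN N → ℝ := fun y => dil φ t (x - y) with hu
    have hw := S.atom_continuous hη hf
    have hi1 : Integrable fun y => (η y * u y) • f y :=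
      ((hη.smooth.continuous.mul hus.continuous).smul hf).integrable_of_hasCompactSupport
        hη.compact.mul_right.smul_right
    have hi2 : Integrable fun y => u y • (η y • f y - S.atom x₀ r η f y) :=
      (hus.continuous.smul
        ((hη.smooth.continuous.smul hf).sub hw)).integrable_of_hasCompactSupport
        (hφ.dil_compact ht x).smul_right
    have e : convAt φ t (S.atom x₀ r η f) x = (∫ y, (η y * u y) • f y) -
        ∫ y, u y • (η y • f y - S.atom x₀ r η f y) := by
      rw [convAt, ← integral_sub hi1 hi2]
      congr 1; funext y
      rw [smul_sub, smul_smul, mul_comm (u y) (η y), sub_sub_cancel]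
    have h2t : (0 : ℝ) < 2 * t := by positivity
    have h1 : ‖∫ y, (η y * u y) • f y‖ ≤ 2 ^ n * (2 ^ n * (H * Cφ)) * 2 ^ N * A := by
      have h := le_grandMax_of_scaledBound (L := L) (f := f) (x := x) (s := 2 * t)
        (B := 2 ^ n * (2 ^ n * (H * (Cφ / t ^ N)))) h2t (by positivity) (hη.smooth.mul hus)
        (tsupport_mul_subset_right.trans ((hφ.dil_tsupport ht x).trans
          (closedBall_subset_ball (by linarith)))) fun z => by
          have h3 := (hη.bound z).change_scale hr ht le_rfl (by linarith : t ≤ 1 * r)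
          rw [one_pow, one_mul] at h3
          have h4 := ScaledBound.mul ht (hη.of_le n) (hus.of_le (by exact_mod_cast le_top)) h3
            (hCφ x t ht z)
          exact (h4.change_scale ht h2t one_le_two le_rfl).mono h2t hL le_rfl
      have h' := h.trans (mul_le_mul_right hM _)
      rw [← ENNReal.ofReal_mul (by positivity), ENNReal.ofReal_le_ofReal_iff (by positivity)] at h'
      refine h'.trans (le_of_eq ?_)
      rw [mul_pow]; field_simp
    have h2 : ‖∫ y, u y • (η y • f y - S.atom x₀ r η f y)‖ ≤ K₁ * A := by
      refine (norm_integral_le_of_norm_le (g := fun y => u y * (K₁ * A))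
        ((hφ.dil_integrable ht x).mul_const _) (Eventually.of_forall fun y => ?_)).trans ?_
      · rw [norm_smul, Real.norm_of_nonneg (hφ.dil_nonneg ht _)]
        exact mul_le_mul_of_nonneg_left (hK₁ x₀ r η hr hη f A hf hA0 hA y) (hφ.dil_nonneg ht _)
      · rw [integral_mul_const, hu, hφ.integral_dil ht, one_mul]
    rw [e, add_mul, add_mul]
    refine (norm_sub_le _ _).trans ((add_le_add h1 h2).trans ?_)
    exact le_add_of_nonneg_right (by positivity)

lemma exists_convAt_atom_far (hφ : GoodPhi φ) (hL : L ≤ n) (hC : S.BoundedBy C) (hH : 1 ≤ H) :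
    ∃ K, 0 ≤ K ∧ ∀ (x₀ : RN N) (r : ℝ) (η : RN N → ℝ), 0 < r → IsCutoff n H x₀ r η →
      ∀ (f : RN N → ℂ) (A : ℝ) (x : RN N), Continuous f → 0 ≤ A → TestBound L x₀ r A f →
        20 * r ≤ dist x x₀ →
        ∀ t, 0 < t → ‖convAt φ t (S.atom x₀ r η f) x‖ ≤ K * A * (r / dist x x₀) ^ (N + n) := by
  obtain ⟨Cφ, hCφ1, hCφ⟩ := hφ.exists_dil_bound n
  obtain ⟨K₂, hK₂0, hK₂⟩ := S.exists_test_atom_bound hL hC (zero_le_one.trans hH)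
  refine ⟨K₂ * Cφ * 2 ^ (N + n), by positivity,
    fun x₀ r η hr hη f A x hf hA0 hA hx t ht => ?_⟩
  have hd : 0 < dist x x₀ := by linarith
  rcases lt_or_ge t (dist x x₀ / 2) with htd | htd
  · have : convAt φ t (S.atom x₀ r η f) x = 0 := by
      refine integral_eq_zero_of_ae (Eventually.of_forall fun y => ?_)
      by_cases hy : y ∈ closedBall x₀ (10 * r)
      · have hy' : y ∉ closedBall x t := fun h => by
          rw [mem_closedBall] at h hy
          have := dist_triangle x y x₀
          rw [dist_comm x y] at this
          linarith
        have h0 := image_eq_zero_of_notMem_tsupport fun h => hy' (hφ.dil_tsupport ht x h)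
        simp [h0]
      · simp [S.atom_eq_zero hr hη f hy]
    rw [this, norm_zero]; positivity
  · have h1 := hK₂ x₀ r η hr hη f A hf hA (fun y => dil φ t (x - y)) (Cφ / t ^ N / t ^ n)
      (hφ.dil_smooth t x) fun z => hCφ x t ht z n le_rfl
    refine h1.trans ?_
    have h2 : r ^ (N + n) * (Cφ / t ^ N / t ^ n) ≤ Cφ * 2 ^ (N + n) * (r / dist x x₀) ^ (N + n) := by
      have h3 : r / t ≤ 2 * (r / dist x x₀) := by
        rw [mul_div_assoc', div_le_div_iff₀ ht hd]
        nlinarith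
      calc r ^ (N + n) * (Cφ / t ^ N / t ^ n) = Cφ * (r / t) ^ (N + n) := by
            rw [div_div, ← pow_add, div_pow]; ring
        _ ≤ Cφ * (2 * (r / dist x x₀)) ^ (N + n) := by gcongr
        _ = _ := by rw [mul_pow]; ring
    calc K₂ * (r ^ (N + n) * (Cφ / t ^ N / t ^ n) * A)
        ≤ K₂ * (Cφ * 2 ^ (N + n) * (r / dist x x₀) ^ (N + n) * A) := by gcongr
      _ = _ := by ring

end DualSystem

lemma lintegral_rescale {r : ℝ} (hr : 0 < r) (x₀ : RN N) {h : RN N → ℝ≥0∞} (hh : Measurable h) :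
    ∫⁻ x, h (r⁻¹ • (x - x₀)) = ENNReal.ofReal (r ^ N) * ∫⁻ x, h x := by
  rw [lintegral_sub_right_eq_self (fun x => h (r⁻¹ • x)) x₀]
  rw [← lintegral_map hh (measurable_const_smul r⁻¹),
    Measure.map_addHaar_smul volume (inv_ne_zero hr.ne'), lintegral_smul_measure,
    finrank_euclideanSpace_fin, inv_pow, inv_inv, abs_of_pos (by positivity), smul_eq_mul]

lemma isClosed_cube (c : RN N) (ℓ : ℝ) : IsClosed (cube c ℓ) := by
  have : cube c ℓ = ⋂ i, {y : RN N | |y i - c i| ≤ ℓ / 2} := by ext; simp [cube]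
  rw [this]
  exact isClosed_iInter fun i => isClosed_le (by fun_prop) continuous_const

lemma closedBall_subset_cube (c : RN N) (ℓ : ℝ) : closedBall c (ℓ / 2) ⊆ cube c ℓ := by
  intro y hy i
  rw [mem_closedBall, dist_eq_norm] at hy
  exact (PiLp.norm_apply_le (y - c) i).trans hy

lemma cube_subset_closedBall (c : RN N) (ℓ : ℝ) : cube c ℓ ⊆ closedBall c (N * (ℓ / 2)) := by
  intro y hy
  rw [mem_closedBall, dist_eq_norm]
  have h : y - c = ∑ i, (y i - c i) • EuclideanSpace.single i (1 : ℝ) := by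
    ext j
    simp [Pi.single_apply]
  rw [h]
  refine (norm_sum_le _ _).trans ?_
  calc _ ≤ ∑ _i : Fin N, ℓ / 2 := by
        refine Finset.sum_le_sum fun i _ => ?_
        rw [norm_smul, PiLp.norm_single, norm_one, mul_one]
        exact hy i
    _ = _ := by simp

end AtomMaximal
section AtomHardyNorm

variable {n : ℕ} {φ : RN N → ℝ}

lemma DualSystem.exists_lintegral_maximal_atom (S : DualSystem N n) {C H : ℝ} {L : ℕ}
    (hφ : GoodPhi φ) (hL : L ≤ n) (hC : S.BoundedBy C) (hH : 1 ≤ H) {p : ℝ} (hp : 0 < p)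
    (hq : (N : ℝ) < (N + n : ℕ) * p) {C₀ : ℝ} (hC₀ : 0 ≤ C₀) :
    ∃ K : ℝ, 0 ≤ K ∧ ∀ (x₀ : RN N) (r : ℝ) (η : RN N → ℝ), 0 < r → IsCutoff n H x₀ r η →
      ∀ (f : RN N → ℂ) (α : ℝ), Continuous f → 0 < α → TestBound L x₀ r (C₀ * α) f →
        cube x₀ (40 * r) ⊆ {x | ENNReal.ofReal α < grandMax L f x} →
        ∫⁻ x, (⨆ (t : ℝ) (_ : 0 < t), ENNReal.ofReal ‖convAt φ t (S.atom x₀ r η f) x‖) ^ p ≤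
          ENNReal.ofReal K * ∫⁻ x in cube x₀ (40 * r), grandMax L f x ^ p := by
  obtain ⟨K₁, hK₁0, hK₁⟩ := S.exists_convAt_atom_near hφ hL hC hH
  obtain ⟨K₂, hK₂0, hK₂⟩ := S.exists_convAt_atom_far hφ hL hC hH
  set C₁ : ℝ := (20 * N + 11) ^ (L + N) with hC₁
  have hC₁1 : 1 ≤ C₁ := one_le_pow₀ (by have := N.cast_nonneg (α := ℝ); linarith)
  set a : ℝ := K₁ * C₁ + 1 with ha
  have ha0 : 0 < a := by positivity
  set q : ℝ := (N + n : ℕ) * p with hqdef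
  set W : ℝ≥0∞ := ∫⁻ x : RN N, ENNReal.ofReal ((1 + ‖x‖) ^ (-q)) with hW
  have hWtop : W < ∞ := finite_integral_one_add_norm (by rw [finrank_euclideanSpace_fin]; exact hq)
  set v : ℝ≥0∞ := volume (ball (0 : RN N) 1) with hv
  have hv0 : v ≠ 0 := (measure_ball_pos volume _ one_pos).ne'
  have hvtop : v ≠ ∞ := measure_ball_lt_top.ne
  set b : ℝ := (K₂ * C₀) ^ p * 2 ^ q with hb
  have hb0 : 0 ≤ b := by positivity
  have hκ : ENNReal.ofReal b * (W / v) ≠ ∞ :=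
    ENNReal.mul_ne_top ENNReal.ofReal_ne_top (ENNReal.div_ne_top hWtop.ne hv0)
  refine ⟨a ^ p + (ENNReal.ofReal b * (W / v)).toReal, by positivity,
    fun x₀ r η hr hη f α hf hα hA hsub => ?_⟩
  have hmeas : MeasurableSet (cube x₀ (40 * r)) := (isClosed_cube _ _).measurableSet
  rw [ENNReal.ofReal_add (by positivity) (by positivity), ENNReal.ofReal_toReal hκ, add_mul,
    ← lintegral_add_compl _ hmeas]
  refine add_le_add ?_ ?_
  · rw [← lintegral_const_mul' _ _ ENNReal.ofReal_ne_top]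
    refine setLIntegral_mono' hmeas fun x hx => ?_
    rw [← ENNReal.ofReal_rpow_of_pos ha0, ← ENNReal.mul_rpow_of_nonneg _ _ hp.le]
    refine ENNReal.rpow_le_rpow (iSup₂_le fun t ht => ?_) hp.le
    rcases eq_or_ne (grandMax L f x) ∞ with htop | htop
    · rw [htop, ENNReal.mul_top (by simpa using ha0)]; exact le_top
    have hx1 : dist x₀ x ≤ (20 * N) * r := by
      have := cube_subset_closedBall _ _ hx
      rw [mem_closedBall, dist_comm] at this
      linarith
    have hMx : grandMax L f x ≤ ENNReal.ofReal (grandMax L f x).toReal :=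
      (ENNReal.ofReal_toReal htop).ge
    have hT := testBound_of_grandMax_le hr (by positivity) hx1 ENNReal.toReal_nonneg hMx
    have h1 := hK₁ x₀ r η hr hη f _ x hf (by positivity) hT
      (hMx.trans (ENNReal.ofReal_le_ofReal (le_mul_of_one_le_left ENNReal.toReal_nonneg hC₁1))) t ht
    calc ENNReal.ofReal ‖convAt φ t (S.atom x₀ r η f) x‖
        ≤ ENNReal.ofReal (a * (grandMax L f x).toReal) := by
          refine ENNReal.ofReal_le_ofReal (h1.trans ?_)
          rw [← mul_assoc]
          gcongr
          rw [ha, hC₁]; linarith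
      _ = _ := by rw [ENNReal.ofReal_mul ha0.le, ENNReal.ofReal_toReal htop]
  · have hfar : ∀ x ∈ (cube x₀ (40 * r))ᶜ,
        (⨆ (t : ℝ) (_ : 0 < t), ENNReal.ofReal ‖convAt φ t (S.atom x₀ r η f) x‖) ^ p ≤
          ENNReal.ofReal (b * α ^ p) * ENNReal.ofReal ((1 + ‖r⁻¹ • (x - x₀)‖) ^ (-q)) := by
      intro x hx
      have hd : 20 * r ≤ dist x x₀ := by
        by_contra! hlt
        exact hx (closedBall_subset_cube _ _ (by rw [mem_closedBall]; linarith))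
      have hd0 : 0 < dist x x₀ := by linarith
      have h1 : (⨆ (t : ℝ) (_ : 0 < t), ENNReal.ofReal ‖convAt φ t (S.atom x₀ r η f) x‖) ≤
          ENNReal.ofReal (K₂ * (C₀ * α) * (r / dist x x₀) ^ (N + n)) :=
        iSup₂_le fun t ht => ENNReal.ofReal_le_ofReal
          (hK₂ x₀ r η hr hη f _ x hf (by positivity) hA hd t ht)
      refine (ENNReal.rpow_le_rpow h1 hp.le).trans ?_
      rw [ENNReal.ofReal_rpow_of_nonneg (by positivity) hp.le, ← ENNReal.ofReal_mul (by positivity)]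
      refine ENNReal.ofReal_le_ofReal ?_
      rw [Real.mul_rpow (by positivity) (by positivity), ← mul_assoc,
        Real.mul_rpow (by positivity) hα.le, ← Real.rpow_natCast_mul (by positivity), ← hqdef]
      have h2 : r / dist x x₀ ≤ 2 * (1 + ‖r⁻¹ • (x - x₀)‖)⁻¹ := by
        rw [norm_smul, norm_inv, Real.norm_of_nonneg hr.le, ← dist_eq_norm, ← div_eq_mul_inv,
          div_le_div_iff₀ hd0 (by positivity)]
        have : r * (r⁻¹ * dist x x₀) = dist x x₀ := by field_simp
        nlinarith
      have hq0 : 0 ≤ q := by positivity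
      calc (K₂ * C₀) ^ p * α ^ p * (r / dist x x₀) ^ q
          ≤ (K₂ * C₀) ^ p * α ^ p * (2 * (1 + ‖r⁻¹ • (x - x₀)‖)⁻¹) ^ q := by gcongr
        _ = _ := by
          rw [Real.mul_rpow zero_le_two (by positivity), Real.inv_rpow (by positivity),
            Real.rpow_neg (by positivity), hb]
          ring
    have hlow : ENNReal.ofReal (α ^ p) * (ENNReal.ofReal (r ^ N) * v) ≤
        ∫⁻ x in cube x₀ (40 * r), grandMax L f x ^ p := by
      calc ENNReal.ofReal (α ^ p) * (ENNReal.ofReal (r ^ N) * v)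
          = ENNReal.ofReal (α ^ p) * volume (closedBall x₀ r) := by
            rw [Measure.addHaar_closedBall volume x₀ hr.le, finrank_euclideanSpace_fin]
        _ ≤ ENNReal.ofReal (α ^ p) * volume (cube x₀ (40 * r)) := by
            gcongr
            exact (closedBall_subset_closedBall (by linarith)).trans (closedBall_subset_cube _ _)
        _ = ∫⁻ x in cube x₀ (40 * r), ENNReal.ofReal (α ^ p) := by rw [setLIntegral_const]
        _ ≤ _ := by
            refine setLIntegral_mono' hmeas fun x hx => ?_
            rw [← ENNReal.ofReal_rpow_of_pos hα]
            exact ENNReal.rpow_le_rpow (hsub hx).le hp.le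
    calc _ ≤ ∫⁻ x in (cube x₀ (40 * r))ᶜ,
          ENNReal.ofReal (b * α ^ p) * ENNReal.ofReal ((1 + ‖r⁻¹ • (x - x₀)‖) ^ (-q)) :=
          setLIntegral_mono' hmeas.compl hfar
      _ ≤ ∫⁻ x, ENNReal.ofReal (b * α ^ p) * ENNReal.ofReal ((1 + ‖r⁻¹ • (x - x₀)‖) ^ (-q)) :=
          setLIntegral_le_lintegral _ _
      _ = ENNReal.ofReal (b * α ^ p) * (ENNReal.ofReal (r ^ N) * W) := by
          rw [lintegral_const_mul' _ _ ENNReal.ofReal_ne_top, lintegral_rescale hr x₀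
            (h := fun y => ENNReal.ofReal ((1 + ‖y‖) ^ (-q))) (by fun_prop)]
      _ = ENNReal.ofReal b * (W / v) * (ENNReal.ofReal (α ^ p) * (ENNReal.ofReal (r ^ N) * v)) := by
          have hWv : W = W / v * v := (ENNReal.div_mul_cancel hv0 hvtop).symm
          conv_lhs => rw [hWv]
          rw [ENNReal.ofReal_mul hb0]
          ring
      _ ≤ _ := by gcongr

end AtomHardyNorm
section Whitney

variable {n : ℕ}

lemma card_le_of_pairwiseDisjoint_closedBall {ι : Type*} {s : Finset ι} {c : ι → RN N} {y : RN N}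
    {ρ R : ℝ} (hρ : 0 < ρ) (hR : 0 ≤ R)
    (hd : (s : Set ι).PairwiseDisjoint fun j => closedBall (c j) ρ)
    (hy : ∀ j ∈ s, dist (c j) y ≤ R * ρ) : (s.card : ℝ) ≤ (R + 1) ^ N := by
  have h1 : ∑ j ∈ s, volume (closedBall (c j) ρ) ≤ volume (closedBall y ((R + 1) * ρ)) := by
    rw [← measure_biUnion_finset hd fun j _ => measurableSet_closedBall]
    refine measure_mono (iUnion₂_subset fun j hj => closedBall_subset_closedBall' ?_)
    linarith [hy j hj]
  simp_rw [Measure.addHaar_closedBall volume _ hρ.le] at h1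
  rw [Measure.addHaar_closedBall volume _ (by positivity), Finset.sum_const, nsmul_eq_mul,
    ← mul_assoc, finrank_euclideanSpace_fin, ENNReal.mul_le_mul_iff_left
      (measure_ball_pos volume _ one_pos).ne' measure_ball_lt_top.ne, ← ENNReal.ofReal_natCast,
    ← ENNReal.ofReal_mul (by positivity), ENNReal.ofReal_le_ofReal_iff (by positivity),
    mul_pow] at h1
  exact le_of_mul_le_mul_right h1 (by positivity)

/-- A Whitney family of balls for the set `Ω`, with ratio `A` between the distance to the
complement and the radius. -/
structure IsWhitney (Ω : Set (RN N)) (A : ℝ) (K : Set ℕ) (c : ℕ → RN N) (r : ℕ → ℝ) : Prop where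
  pos : ∀ k ∈ K, 0 < r k
  infDist_eq : ∀ k ∈ K, infDist (c k) Ωᶜ = A * r k
  disjoint : K.PairwiseDisjoint fun k => closedBall (c k) (r k)
  cover : ∀ x ∈ Ω, ∃ k ∈ K, x ∈ closedBall (c k) (5 * r k)

lemma exists_isWhitney {Ω : Set (RN N)} (ho : IsOpen Ω) (hb : Bornology.IsBounded Ω)
    (hne : Ωᶜ.Nonempty) {A : ℝ} (hA : 0 < A) : ∃ K c r, IsWhitney Ω A K c r := by
  have hpos : ∀ x ∈ Ω, 0 < infDist x Ωᶜ := fun x hx =>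
    (ho.isClosed_compl.notMem_iff_infDist_pos hne).1 (not_not.2 hx)
  obtain ⟨z, hz⟩ := hne
  obtain ⟨R, hR⟩ := hb.subset_closedBall z
  obtain ⟨u, huΩ, hud, huc⟩ := Vitali.exists_disjoint_subfamily_covering_enlargement_closedBall Ω
    id (fun x => infDist x Ωᶜ / A) (R / A)
    (fun x hx => by
      gcongr
      exact (infDist_le_dist_of_mem hz).trans (hR hx)) 5 (by norm_num)
  have hcount : u.Countable := hud.countable_of_nonempty_interior fun x hx =>
    ⟨x, ball_subset_interior_closedBall (mem_ball_self (div_pos (hpos x (huΩ hx)) hA))⟩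
  obtain ⟨g, hg⟩ := Set.countable_iff_exists_injOn.1 hcount
  set c : ℕ → RN N := Function.invFunOn g u with hc
  have hcg : ∀ x ∈ u, c (g x) = x := fun x hx => hg.leftInvOn_invFunOn hx
  refine ⟨Set.image g u, c, fun k => infDist (c k) Ωᶜ / A, ?_, ?_, ?_, ?_⟩
  · rintro _ ⟨x, hx, rfl⟩
    rw [hcg x hx]
    exact div_pos (hpos x (huΩ hx)) hA
  · intro k _
    field_simp
  · rintro _ ⟨x, hx, rfl⟩ _ ⟨y, hy, rfl⟩ hxy
    have := hud hx hy fun h => hxy (by rw [h])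
    simpa only [Function.onFun, hcg x hx, hcg y hy, id] using this
  · intro x hx
    obtain ⟨y, hy, hxy⟩ := huc x hx
    refine ⟨g y, ⟨y, hy, rfl⟩, ?_⟩
    rw [hcg y hy]
    exact hxy (mem_closedBall_self (div_pos (hpos x hx) hA).le)

namespace IsWhitney

variable {Ω : Set (RN N)} {A : ℝ} {K : Set ℕ} {c : ℕ → RN N} {r : ℕ → ℝ}

lemma infDist_mem_Icc (h : IsWhitney Ω A K c r) {k : ℕ} (hk : k ∈ K) {x : RN N}
    (hx : x ∈ closedBall (c k) (A / 2 * r k)) :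
    infDist x Ωᶜ ∈ Icc (A / 2 * r k) (3 * (A / 2) * r k) := by
  have h1 := h.infDist_eq k hk
  have h2 := infDist_le_infDist_add_dist (s := Ωᶜ) (x := x) (y := c k)
  have h3 := infDist_le_infDist_add_dist (s := Ωᶜ) (x := c k) (y := x)
  rw [mem_closedBall] at hx
  rw [dist_comm] at h3
  constructor <;> linarith

lemma closedBall_subset (h : IsWhitney Ω A K c r) (hA : 0 < A) {k : ℕ} (hk : k ∈ K) :
    closedBall (c k) (A / 2 * r k) ⊆ Ω := by
  intro x hx
  by_contra hxn
  have h1 := (h.infDist_mem_Icc hk hx).1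
  rw [infDist_zero_of_mem (mem_compl hxn)] at h1
  have := h.pos k hk
  exact absurd h1 (not_le.2 (by positivity))

lemma radius_le (h : IsWhitney Ω A K c r) (hA : 0 < A) {j k : ℕ} (hj : j ∈ K) (hk : k ∈ K)
    (hjk : (closedBall (c j) (A / 2 * r j) ∩ closedBall (c k) (A / 2 * r k)).Nonempty) :
    r j ≤ 3 * r k := by
  obtain ⟨x, hxj, hxk⟩ := hjk
  have h1 := (h.infDist_mem_Icc hj hxj).1.trans (h.infDist_mem_Icc hk hxk).2
  have : A / 2 * r j ≤ A / 2 * (3 * r k) := by linarith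
  exact le_of_mul_le_mul_left this (by positivity)

/-- The members of the family whose enlarged balls meet the `k`-th one. -/
def neighbors (A : ℝ) (K : Set ℕ) (c : ℕ → RN N) (r : ℕ → ℝ) (k : ℕ) : Set ℕ :=
  {j | j ∈ K ∧ (closedBall (c j) (A / 2 * r j) ∩ closedBall (c k) (A / 2 * r k)).Nonempty}

lemma card_le_of_subset_neighbors (h : IsWhitney Ω A K c r) (hA : 0 < A) {k : ℕ} (hk : k ∈ K)
    {s : Finset ℕ} (hs : (s : Set ℕ) ⊆ neighbors A K c r k) : (s.card : ℝ) ≤ (6 * A + 1) ^ N := by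
  have hrk := h.pos k hk
  refine card_le_of_pairwiseDisjoint_closedBall (c := c) (y := c k) (ρ := r k / 3) (by positivity)
    (by positivity) ?_ fun j hj => ?_
  · intro i hi j hj hij
    have hi' := hs hi
    have hj' := hs hj
    refine (h.disjoint hi'.1 hj'.1 hij).mono (closedBall_subset_closedBall ?_)
      (closedBall_subset_closedBall ?_)
    · have := h.radius_le hA hk hi'.1 (by rw [inter_comm]; exact hi'.2)
      linarith
    · have := h.radius_le hA hk hj'.1 (by rw [inter_comm]; exact hj'.2)
      linarith
  · have hj' := hs hj
    have h1 := h.radius_le hA hj'.1 hk hj'.2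
    obtain ⟨x, hxj, hxk⟩ := hj'.2
    rw [mem_closedBall] at hxj hxk
    have := dist_triangle_left (c j) (c k) x
    nlinarith

lemma neighbors_finite (h : IsWhitney Ω A K c r) (hA : 0 < A) {k : ℕ} (hk : k ∈ K) :
    (neighbors A K c r k).Finite := by
  by_contra hinf
  obtain ⟨s, hs, hcard⟩ := (show (neighbors A K c r k).Infinite from hinf).exists_subset_card_eq
    (⌊(6 * A + 1) ^ N⌋₊ + 1)
  have h1 := h.card_le_of_subset_neighbors hA hk hs
  rw [hcard] at h1
  exact absurd h1 (not_le.2 (by push_cast; exact Nat.lt_floor_add_one _))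

lemma overlap (h : IsWhitney Ω A K c r) (hA : 0 < A) (x : RN N) :
    {k | k ∈ K ∧ x ∈ closedBall (c k) (A / 2 * r k)}.Finite ∧
      (({k | k ∈ K ∧ x ∈ closedBall (c k) (A / 2 * r k)}.ncard : ℕ) : ℝ) ≤ (6 * A + 1) ^ N := by
  rcases Set.eq_empty_or_nonempty {k | k ∈ K ∧ x ∈ closedBall (c k) (A / 2 * r k)} with h0 | ⟨k, hk⟩
  · rw [h0]
    exact ⟨finite_empty, by rw [ncard_empty, Nat.cast_zero]; positivity⟩
  · have hsub : {k | k ∈ K ∧ x ∈ closedBall (c k) (A / 2 * r k)} ⊆ neighbors A K c r k :=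
      fun j hj => ⟨hj.1, x, hj.2, hk.2⟩
    have hfin := (h.neighbors_finite hA hk.1).subset hsub
    refine ⟨hfin, ?_⟩
    rw [Set.ncard_eq_toFinset_card _ hfin]
    exact h.card_le_of_subset_neighbors hA hk.1 (by simpa using hsub)

end IsWhitney

lemma ScaledBound.prod {ι : Type*} {r B : ℝ} (hr : 0 < r) {h : ι → RN N → ℝ}
    {x : RN N} (s : Finset ι) (hh : ∀ j ∈ s, ContDiff ℝ (n : ℕ∞) (h j))
    (hb : ∀ j ∈ s, ScaledBound n r B (h j) x) :
    ScaledBound n r ((2 ^ n * B) ^ s.card) (fun y => ∏ j ∈ s, h j y) x := by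
  classical
  induction s using Finset.induction_on with
  | empty =>
    have := ScaledBound.const (n := n) hr (1 : ℝ) x
    simpa using this
  | insert j s hj ih =>
    simp only [Finset.prod_insert hj, Finset.card_insert_of_notMem hj]
    refine (ScaledBound.mul hr (hh j (Finset.mem_insert_self _ _))
      (contDiff_prod fun i hi => hh i (Finset.mem_insert_of_mem hi))
      (hb j (Finset.mem_insert_self _ _))
      (ih (fun i hi => hh i (Finset.mem_insert_of_mem hi))
        fun i hi => hb i (Finset.mem_insert_of_mem hi))).mono hr le_rfl (le_of_eq ?_)
    ring

/-- A smooth bump function equal to one on the ball of radius `5` and supported in the ball of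
radius `10`. -/
def wideBump (N : ℕ) : ContDiffBump (0 : RN N) := ⟨5, 10, by norm_num, by norm_num⟩

/-- The rescaled bump function. -/
def wideBumpAt (x₀ : RN N) (r : ℝ) (x : RN N) : ℝ := wideBump N (r⁻¹ • (x - x₀))

lemma wideBumpAt_smooth (x₀ : RN N) (r : ℝ) : ContDiff ℝ (⊤ : ℕ∞) (wideBumpAt x₀ r) :=
  smooth_rescale r x₀ (wideBump N).contDiff

lemma wideBump_tsupport : tsupport (wideBump N) ⊆ closedBall 0 10 := by
  rw [(wideBump N).tsupport_eq]; rfl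

lemma wideBumpAt_tsupport (x₀ : RN N) {r : ℝ} (hr : 0 < r) :
    tsupport (wideBumpAt x₀ r) ⊆ closedBall x₀ (10 * r) :=
  tsupport_rescale hr x₀ wideBump_tsupport

lemma wideBumpAt_eq_one {x₀ x : RN N} {r : ℝ} (hr : 0 < r) (hx : x ∈ closedBall x₀ (5 * r)) :
    wideBumpAt x₀ r x = 1 := by
  refine (wideBump N).one_of_mem_closedBall ?_
  rw [mem_closedBall, dist_eq_norm] at hx
  rw [mem_closedBall_zero_iff, norm_smul, norm_inv, Real.norm_of_nonneg hr.le,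
    inv_mul_le_iff₀ hr]
  exact hx.trans (le_of_eq (mul_comm _ _))

lemma exists_wideBumpAt_bound (N n : ℕ) : ∃ C, 1 ≤ C ∧ ∀ (x₀ : RN N) (r : ℝ), 0 < r →
    ∀ x, ScaledBound n r C (wideBumpAt x₀ r) x := by
  obtain ⟨C, -, hC⟩ := exists_bound_iteratedFDeriv (wideBump N).contDiff n wideBump_tsupport
  refine ⟨max C 1, le_max_right _ _, fun x₀ r hr x => ?_⟩
  exact ScaledBound.rescale hr x₀ x ((wideBump N).contDiff.of_le (by exact_mod_cast le_top))
    fun i hi => (hC i hi _).trans (le_max_left _ _)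

open scoped Classical in
/-- The partition of unity subordinate to a family of balls. -/
def whitneyCutoff (K : Set ℕ) (c : ℕ → RN N) (r : ℕ → ℝ) (k : ℕ) (x : RN N) : ℝ :=
  wideBumpAt (c k) (r k) x * ∏ j ∈ Finset.range k with j ∈ K, (1 - wideBumpAt (c j) (r j) x)

lemma exists_whitneyCutoff_bound (N n : ℕ) {A : ℝ} (hA : 20 ≤ A) :
    ∃ H, 1 ≤ H ∧ ∀ (Ω : Set (RN N)) K c r, IsWhitney Ω A K c r →
      ∀ k ∈ K, IsCutoff n H (c k) (r k) (whitneyCutoff K c r k) := by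
  classical
  obtain ⟨C, hC1, hC⟩ := exists_wideBumpAt_bound N n
  have hA0 : 0 < A := by linarith
  set V : ℕ := ⌊(6 * A + 1) ^ N⌋₊ with hV
  have h2n : (1 : ℝ) ≤ 2 ^ n := one_le_pow₀ one_le_two
  set B : ℝ := 1 + 3 ^ n * C with hB
  have hB1 : 1 ≤ B := le_add_of_nonneg_right (by positivity)
  have hbase : 1 ≤ 2 ^ n * B := one_le_mul_of_one_le_of_one_le h2n hB1
  refine ⟨2 ^ n * (C * (2 ^ n * B) ^ V), one_le_mul_of_one_le_of_one_le h2n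
    (one_le_mul_of_one_le_of_one_le hC1 (one_le_pow₀ hbase)), fun Ω K c r h k hk => ?_⟩
  have hr := h.pos k hk
  have hsm : ∀ j, ContDiff ℝ (⊤ : ℕ∞) fun x => 1 - wideBumpAt (c j) (r j) x := fun j =>
    contDiff_const.sub (wideBumpAt_smooth _ _)
  have heq : whitneyCutoff K c r k = fun x => wideBumpAt (c k) (r k) x *
      ∏ j ∈ Finset.range k with j ∈ IsWhitney.neighbors A K c r k, (1 - wideBumpAt (c j) (r j) x) := by
    funext x
    rw [whitneyCutoff]
    by_cases hx : x ∈ closedBall (c k) (10 * r k)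
    · congr 1
      refine (Finset.prod_subset (fun j hj => ?_) fun j hj hjn => ?_).symm
      · rw [Finset.mem_filter] at hj ⊢
        exact ⟨hj.1, hj.2.1⟩
      · rw [Finset.mem_filter] at hj hjn
        have hrj := h.pos j hj.2
        have hxj : x ∉ closedBall (c j) (10 * r j) := fun hxj =>
          hjn ⟨hj.1, hj.2, x, closedBall_subset_closedBall (by nlinarith) hxj,
            closedBall_subset_closedBall (by nlinarith) hx⟩
        rw [image_eq_zero_of_notMem_tsupport fun h' => hxj (wideBumpAt_tsupport _ hrj h'), sub_zero]
    · rw [image_eq_zero_of_notMem_tsupport fun h' => hx (wideBumpAt_tsupport _ hr h'), zero_mul,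
        zero_mul]
  have hcard : (Finset.card {j ∈ Finset.range k | j ∈ IsWhitney.neighbors A K c r k}) ≤ V :=
    Nat.le_floor (h.card_le_of_subset_neighbors hA0 hk fun j hj => (Finset.mem_filter.1 hj).2)
  refine ⟨?_, ?_, fun x => ?_⟩
  · rw [heq]
    exact (wideBumpAt_smooth _ _).mul (contDiff_prod fun j _ => hsm j)
  · rw [heq]
    exact (tsupport_mul_subset_left).trans (wideBumpAt_tsupport _ hr)
  · rw [heq]
    have hprod := ScaledBound.prod hr (B := B) (n := n)
      {j ∈ Finset.range k | j ∈ IsWhitney.neighbors A K c r k}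
      (h := fun j x => 1 - wideBumpAt (c j) (r j) x) (x := x)
      (fun j _ => (hsm j).of_le (by exact_mod_cast le_top)) fun j hj => by
        have hj' := (Finset.mem_filter.1 hj).2
        have hrk := h.radius_le hA0 hk hj'.1 (by rw [inter_comm]; exact hj'.2)
        have h1 := (hC (c j) (r j) (h.pos j hj'.1) x).change_scale (h.pos j hj'.1) hr
          (by norm_num) hrk
        have h2 := ScaledBound.const (n := n) hr (1 : ℝ) x
        rw [norm_one] at h2
        exact ScaledBound.sub contDiff_const ((wideBumpAt_smooth _ _).of_le
          (by exact_mod_cast le_top)) h2 h1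
    refine (ScaledBound.mul hr ((wideBumpAt_smooth _ _).of_le (by exact_mod_cast le_top))
      (contDiff_prod fun j _ => (hsm j).of_le (by exact_mod_cast le_top)) (hC (c k) (r k) hr x)
      hprod).mono hr le_rfl ?_
    gcongr

lemma IsWhitney.sum_whitneyCutoff {Ω : Set (RN N)} {A : ℝ} {K : Set ℕ} {c : ℕ → RN N} {r : ℕ → ℝ}
    (h : IsWhitney Ω A K c r) (hA : 20 ≤ A) {x : RN N} (hx : x ∈ Ω) {s : Finset ℕ}
    (hsK : (s : Set ℕ) ⊆ K) (hs : ∀ k ∈ K, x ∈ closedBall (c k) (A / 2 * r k) → k ∈ s) :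
    ∑ k ∈ s, whitneyCutoff K c r k x = 1 := by
  classical
  obtain ⟨M, hM⟩ := s.exists_nat_subset_range
  have h1 := Finset.prod_one_sub_ordered {k ∈ Finset.range M | k ∈ K}
    fun k => wideBumpAt (c k) (r k) x
  obtain ⟨k₀, hk₀, hxk₀⟩ := h.cover x hx
  have hr₀ := h.pos k₀ hk₀
  have hk₀M : k₀ ∈ Finset.range M :=
    hM (hs k₀ hk₀ (closedBall_subset_closedBall (by nlinarith) hxk₀))
  rw [Finset.prod_eq_zero (i := k₀) (Finset.mem_filter.2 ⟨hk₀M, hk₀⟩)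
    (by rw [wideBumpAt_eq_one hr₀ hxk₀, sub_self])] at h1
  have h2 : ∑ k ∈ s, whitneyCutoff K c r k x =
      ∑ k ∈ Finset.range M with k ∈ K, whitneyCutoff K c r k x := by
    refine Finset.sum_subset (fun k hk => Finset.mem_filter.2 ⟨hM hk, hsK hk⟩) fun k hk hks => ?_
    have hkK := (Finset.mem_filter.1 hk).2
    have hrk := h.pos k hkK
    have hxk : x ∉ closedBall (c k) (10 * r k) := fun hxk =>
      hks (hs k hkK (closedBall_subset_closedBall (by nlinarith) hxk))
    rw [whitneyCutoff,
      image_eq_zero_of_notMem_tsupport fun h' => hxk (wideBumpAt_tsupport _ hrk h'), zero_mul]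
  rw [h2]
  refine Eq.trans (Finset.sum_congr rfl fun k hk => ?_) (sub_eq_zero.1 h1.symm).symm
  rw [whitneyCutoff]
  congr 1
  refine Finset.prod_congr ?_ fun _ _ => rfl
  ext j
  simp only [Finset.mem_filter, Finset.mem_range] at hk ⊢
  constructor
  · rintro ⟨h1, h2⟩; exact ⟨⟨h1.trans hk.1, h2⟩, h1⟩
  · rintro ⟨⟨-, h2⟩, h1⟩; exact ⟨h1, h2⟩

end Whitney
section LevelSets

variable {f : RN N → ℂ} {L : ℕ}

lemma isOpen_lt_grandMax (L : ℕ) (f : RN N → ℂ) (a : ℝ≥0∞) : IsOpen {x | a < grandMax L f x} := by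
  refine isOpen_iff_mem_nhds.2 fun x hx => ?_
  simp only [Set.mem_ofPred_eq, grandMax, lt_iSup_iff] at hx
  obtain ⟨t, ht, ψ, hψ, hlt⟩ := hx
  have h1 : ∀ᶠ y in 𝓝 x, ∀ z ∈ tsupport ψ, dist z y < t := by
    refine IsCompact.eventually_forall_of_forall_eventually hψ.2.1 fun z hz => ?_
    have hc : Continuous fun q : RN N × RN N => dist q.2 q.1 := by fun_prop
    exact hc.continuousAt.eventually_lt_const (hψ.2.2.1 hz)
  filter_upwards [h1] with y hy
  refine hlt.trans_le ?_
  unfold grandMax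
  exact le_iSup₂_of_le t ht (le_iSup₂_of_le ψ ⟨hψ.1, hψ.2.1, hy, hψ.2.2.2⟩ le_rfl)

lemma md_zero (ψ : RN N → ℝ) : md (0 : Fin N → ℕ) ψ = ψ := by
  have h : ∀ l : List ((RN N → ℝ) → RN N → ℝ), (∀ g ∈ l, g = id) → l.foldr (· ∘ ·) id = id := by
    intro l hl
    induction l with
    | nil => rfl
    | cons g l ih =>
      rw [List.foldr_cons, ih fun g hg => hl g (List.mem_cons_of_mem _ hg),
        hl g List.mem_cons_self]
      rfl
  rw [md, h _ fun g hg => ?_]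
  · rfl
  · obtain ⟨i, rfl⟩ := (List.mem_ofFn' _ _).1 hg
    rfl

lemma isBounded_lt_grandMax (hN : 1 ≤ N) (hf : Continuous f) (hc : HasCompactSupport f)
    {α : ℝ} (hα : 0 < α) : Bornology.IsBounded {x | ENNReal.ofReal α < grandMax L f x} := by
  obtain ⟨R, hR⟩ := hc.isCompact.isBounded.subset_closedBall (0 : RN N)
  set I : ℝ := ∫ y, ‖f y‖ with hI
  have hI0 : 0 ≤ I := integral_nonneg fun _ => norm_nonneg _
  have hfi : Integrable f := hf.integrable_of_hasCompactSupport hc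
  set T : ℝ := max 1 (I / α) with hT
  refine (isBounded_closedBall (x := (0 : RN N)) (r := R + T)).subset fun x hx => ?_
  by_contra hxn
  rw [mem_closedBall_zero_iff, not_le] at hxn
  refine absurd (show ENNReal.ofReal α < grandMax L f x from hx) (not_lt.2 ?_)
  unfold grandMax
  refine iSup₂_le fun s hs => iSup₂_le fun ψ hψ => ENNReal.ofReal_le_ofReal ?_
  rcases le_or_gt s T with hsT | hsT
  · have h0 : ∀ z, ψ z • f z = 0 := by
      intro z
      by_cases hz : z ∈ tsupport f
      · have hz1 := hR hz
        rw [mem_closedBall_zero_iff] at hz1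
        have hzn : z ∉ tsupport ψ := fun h => by
          have h1 := hψ.2.2.1 h
          rw [mem_ball, dist_eq_norm, norm_sub_rev] at h1
          have := norm_sub_norm_le x z
          linarith
        rw [image_eq_zero_of_notMem_tsupport hzn, zero_smul]
      · rw [image_eq_zero_of_notMem_tsupport hz, smul_zero]
    simp only [h0, integral_zero, norm_zero]
    exact hα.le
  · have hT1 : 1 ≤ T := le_max_left _ _
    have hT0 : 0 < T := by linarith
    have hψb : ∀ z, ‖ψ z‖ ≤ T⁻¹ := by
      intro z
      have h1 := hψ.2.2.2 0 (by simp [mOrder]) z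
      rw [md_zero, ← Real.norm_eq_abs] at h1
      refine h1.trans ?_
      gcongr
      have h0 : mOrder (0 : Fin N → ℕ) = 0 := by simp [mOrder]
      rw [h0, add_zero]
      calc T ≤ T ^ N := le_self_pow₀ hT1 (by omega)
        _ ≤ s ^ N := by gcongr
    refine (norm_integral_le_of_norm_le (g := fun y => T⁻¹ * ‖f y‖) (hfi.norm.const_mul _)
      (Eventually.of_forall fun y => ?_)).trans ?_
    · rw [norm_smul]
      gcongr
      exact hψb y
    · rw [integral_const_mul, ← hI, inv_mul_le_iff₀ hT0, ← div_le_iff₀ hα]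
      exact le_max_right _ _

lemma GoodPhi.exists_norm_le_of_grandMax_le {φ : RN N → ℝ} (hφ : GoodPhi φ) (L : ℕ) :
    ∃ C, 0 ≤ C ∧ ∀ (f : RN N → ℂ) (α : ℝ) (x : RN N), Continuous f → 0 < α →
      grandMax L f x ≤ ENNReal.ofReal α → ‖f x‖ ≤ C * α := by
  obtain ⟨C, hC1, hC⟩ := hφ.exists_dil_bound L
  refine ⟨2 ^ L * C * 2 ^ N, by positivity, fun f α x hf hα hM => ?_⟩
  refine le_of_forall_pos_le_add fun ε hε => ?_
  obtain ⟨δ, hδ, hfδ⟩ := Metric.continuous_iff.1 hf x ε hε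
  have ht : 0 < δ / 2 := by positivity
  set t : ℝ := δ / 2 with htdef
  have h2t : 0 < 2 * t := by positivity
  have hus := hφ.dil_smooth t x
  have h1 : ‖∫ y, dil φ t (x - y) • f y‖ ≤ 2 ^ L * C * 2 ^ N * α := by
    have h := (le_grandMax_of_scaledBound (L := L) (f := f) (x := x) (s := 2 * t)
      (B := 2 ^ L * (C / t ^ N)) h2t (by positivity) hus
      ((hφ.dil_tsupport ht x).trans (closedBall_subset_ball (by linarith)))
      fun z => (hC x t ht z).change_scale ht h2t one_le_two le_rfl).trans (mul_le_mul_right hM _)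
    rw [← ENNReal.ofReal_mul (by positivity), ENNReal.ofReal_le_ofReal_iff (by positivity)] at h
    refine h.trans (le_of_eq ?_)
    rw [mul_pow]; field_simp
  have hi1 : Integrable fun y => dil φ t (x - y) • f y :=
    (hus.continuous.smul hf).integrable_of_hasCompactSupport (hφ.dil_compact ht x).smul_right
  have hi2 : Integrable fun y => dil φ t (x - y) • (f x - f y) :=
    (hus.continuous.smul (continuous_const.sub hf)).integrable_of_hasCompactSupport
      (hφ.dil_compact ht x).smul_right
  have e : f x = (∫ y, dil φ t (x - y) • f y) + ∫ y, dil φ t (x - y) • (f x - f y) := by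
    rw [← integral_add hi1 hi2]
    simp_rw [← smul_add, add_sub_cancel]
    rw [integral_smul_const, hφ.integral_dil ht, one_smul]
  have h2 : ‖∫ y, dil φ t (x - y) • (f x - f y)‖ ≤ ε := by
    refine (norm_integral_le_of_norm_le (g := fun y => dil φ t (x - y) * ε)
      ((hφ.dil_integrable ht x).mul_const _) (Eventually.of_forall fun y => ?_)).trans ?_
    · rw [norm_smul, Real.norm_of_nonneg (hφ.dil_nonneg ht _)]
      by_cases hy : y ∈ closedBall x t
      · refine mul_le_mul_of_nonneg_left ?_ (hφ.dil_nonneg ht _)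
        rw [← dist_eq_norm, dist_comm]
        exact (hfδ y ((mem_closedBall.1 hy).trans_lt (by rw [htdef]; linarith))).le
      · have h0 := image_eq_zero_of_notMem_tsupport fun h => hy (hφ.dil_tsupport ht x h)
        simp [h0]
    · rw [integral_mul_const, hφ.integral_dil ht, one_mul]
  rw [e]
  exact (norm_add_le _ _).trans (add_le_add h1 h2)

end LevelSets

section CalderonZygmund

lemma DualSystem.exists_supDeriv_atom_bound {n m : ℕ} (S : DualSystem N n) {C H : ℝ}
    (hC : S.BoundedBy C) (hH : 0 ≤ H) (hmn : m ≤ n) :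
    ∃ K, 0 ≤ K ∧ ∀ (x₀ : RN N) (r : ℝ) (η : RN N → ℝ), 0 < r → IsCutoff n H x₀ r η →
      ∀ f : RN N → ℂ, ContDiff ℝ (m : ℕ∞) f → HasCompactSupport f →
      ∀ i j, i ≤ j → j ≤ m →
        supDeriv i (S.atom x₀ r η f) ≤ K * (r ^ (j - i) * supDeriv j f) := by
  obtain ⟨K, hK, hb⟩ := S.exists_atom_bound (F := ℂ) hC hH
  refine ⟨∑ q ∈ Finset.range (m + 1) ×ˢ Finset.range (m + 1),
      ((idxEq N q.1).card : ℝ) * (K * (N : ℝ) ^ q.2), by positivity,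
    fun x₀ r η hr hη f hf hc i j hij hjm => ?_⟩
  have hfj : ContDiff ℝ ((j : ℕ) : ℕ∞) f := hf.of_le (by exact_mod_cast hjm)
  have h1 : ∀ x, ‖iteratedFDeriv ℝ i (S.atom x₀ r η f) x‖ ≤
      K * (r ^ (j - i) * ((N : ℝ) ^ j * supDeriv j f)) := by
    intro x
    have h := hb x₀ r η hr hη j (hjm.trans hmn) f hfj _
      (norm_iteratedFDeriv_le_supDeriv hfj hc) x i hij
    refine h.trans (le_of_eq ?_)
    obtain ⟨d, rfl⟩ := Nat.exists_eq_add_of_le hij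
    rw [Nat.add_sub_cancel_left, pow_add r i d]
    field_simp
  have hsm : ContDiff ℝ ((i : ℕ) : ℕ∞) (S.atom x₀ r η f) :=
    (S.atom_contDiff hη hfj).of_le (by exact_mod_cast hij)
  refine (supDeriv_le hsm h1).trans ?_
  have h2 : ((idxEq N i).card : ℝ) * (K * (N : ℝ) ^ j) ≤
      ∑ q ∈ Finset.range (m + 1) ×ˢ Finset.range (m + 1),
        ((idxEq N q.1).card : ℝ) * (K * (N : ℝ) ^ q.2) :=
    Finset.single_le_sum (f := fun q : ℕ × ℕ => ((idxEq N q.1).card : ℝ) * (K * (N : ℝ) ^ q.2))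
      (fun q _ => by positivity) (a := (i, j))
      (Finset.mem_product.2 ⟨Finset.mem_range.2 (by omega), Finset.mem_range.2 (by omega)⟩)
  have h3 : 0 ≤ r ^ (j - i) * supDeriv j f := mul_nonneg (by positivity) (supDeriv_nonneg j f)
  calc ((idxEq N i).card : ℝ) * (K * (r ^ (j - i) * ((N : ℝ) ^ j * supDeriv j f)))
      = ((idxEq N i).card : ℝ) * (K * (N : ℝ) ^ j) * (r ^ (j - i) * supDeriv j f) := by ring
    _ ≤ _ := mul_le_mul_of_nonneg_right h2 h3

variable {Ω : Set (RN N)} {A : ℝ} {K : Set ℕ} {c : ℕ → RN N} {r : ℕ → ℝ}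

lemma IsWhitney.exists_testBound (h : IsWhitney Ω A K c r) (ho : IsOpen Ω) (hne : Ωᶜ.Nonempty)
    (hA : 0 ≤ A) {L : ℕ} {f : RN N → ℂ} {α : ℝ} (hα : 0 ≤ α)
    (hM : ∀ x ∉ Ω, grandMax L f x ≤ ENNReal.ofReal α) {k : ℕ} (hk : k ∈ K) :
    TestBound L (c k) (r k) ((A + 11) ^ (L + N) * α) f := by
  obtain ⟨x, hx, hd⟩ := ho.isClosed_compl.exists_infDist_eq_dist hne (c k)
  exact testBound_of_grandMax_le (h.pos k hk) hA (by rw [← hd, h.infDist_eq k hk]) hα (hM x hx)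

lemma IsWhitney.cube_subset_closedBall (h : IsWhitney Ω A K c r) (hA : 40 * N ≤ A)
    {k : ℕ} (hk : k ∈ K) : cube (c k) (40 * r k) ⊆ closedBall (c k) (A / 2 * r k) := by
  refine (_root_.cube_subset_closedBall _ _).trans (closedBall_subset_closedBall ?_)
  have := h.pos k hk
  nlinarith

/-- A sum over `K` of terms supported near `x` reduces to the finitely many indices of the
Whitney balls containing `x`. -/
lemma IsWhitney.tsum_eq_sum (h : IsWhitney Ω A K c r) (hA : 20 ≤ A) {u : ℕ → ℂ} (x : RN N)
    (hu : ∀ k ∈ K, x ∉ closedBall (c k) (10 * r k) → u k = 0) :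
    ∑' k : K, u k = ∑ k ∈ (h.overlap (by linarith) x).1.toFinset, u k := by
  rw [tsum_subtype K u]
  refine (_root_.tsum_eq_sum fun k hk => ?_).trans (Finset.sum_congr rfl fun k hk => ?_)
  · by_cases hkK : k ∈ K
    · rw [Set.indicator_of_mem hkK]
      refine hu k hkK fun hx => hk ?_
      have := h.pos k hkK
      exact (Set.Finite.mem_toFinset _).2
        ⟨hkK, closedBall_subset_closedBall (by nlinarith) hx⟩
    · exact Set.indicator_of_notMem hkK u
  · exact Set.indicator_of_mem ((Set.Finite.mem_toFinset _).1 hk).1 u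

end CalderonZygmund

/-- Generalized Calderón–Zygmund decomposition (Proposition 4.2). -/
theorem statement7 {N m : ℕ} (hN : 1 ≤ N) (hm : 1 ≤ m) (p : ℝ)
    (hp₁ : (N : ℝ) / (N + m) < p) (hp₂ : p ≤ 1)
    (L : ℕ) (hL : (N : ℝ) * (1 / p - 1) < L)
    (φ₀ : RN N → ℝ) (hφ₀ : GoodPhi φ₀) :
    ∃ c : ℝ, 0 < c ∧
      ∀ f : RN N → ℂ, ContDiff ℝ ((2 * m - 1 : ℕ) : ℕ∞) f → HasCompactSupport f →
      ∀ α : ℝ, 0 < α →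
        ∃ (K : Set ℕ) (g : RN N → ℂ) (β : ℕ → RN N → ℂ) (ctr : ℕ → RN N) (len : ℕ → ℝ),
          (∀ x : RN N, {k | k ∈ K ∧ β k x ≠ 0}.Finite) ∧
          (∀ x : RN N, f x = g x + ∑' k : K, β (k : ℕ) x) ∧
          (∀ᵐ x : RN N, ‖g x‖ ≤ c * α) ∧
          (∀ k ∈ K, 0 < len k ∧
            ContDiff ℝ (m : ℕ∞) (β k) ∧
            tsupport (β k) ⊆ cube (ctr k) (len k) ∧
            (∀ i : ℕ, i ≤ m - 1 →
              supDeriv i (β k) ≤ c * ∑ j ∈ Finset.range (i + 1),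
                len k ^ (m + j - i) * supDeriv (m + j) f) ∧
            (∀ i : ℕ, 1 ≤ i → i ≤ m → supDeriv i (β k) ≤ c * supDeriv i f) ∧
            (∫⁻ x, (⨆ (t : ℝ) (_ : 0 < t), ENNReal.ofReal ‖convAt φ₀ t (β k) x‖) ^ p) ≤
              ENNReal.ofReal c * ∫⁻ x in cube (ctr k) (len k), grandMax L f x ^ p ∧
            (∀ γ : Fin N → ℕ, mOrder γ ≤ m - 1 →
              ∫ x : RN N, (∏ i, ((x i : ℝ) : ℂ) ^ γ i) * β k x = 0)) ∧
          (∀ x : RN N, {k | k ∈ K ∧ x ∈ cube (ctr k) (len k)}.Finite ∧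
            (({k | k ∈ K ∧ x ∈ cube (ctr k) (len k)}.ncard : ℕ) : ℝ) ≤ c) ∧
          (⋃ k ∈ K, cube (ctr k) (len k)) = {x | ENNReal.ofReal α < grandMax L f x} := by
  have hN0 : (1 : ℝ) ≤ N := by exact_mod_cast hN
  have hm0 : (1 : ℝ) ≤ m := by exact_mod_cast hm
  have hp : 0 < p := lt_of_le_of_lt (by positivity) hp₁
  obtain ⟨n, hLn, hmn⟩ : ∃ n, L ≤ n ∧ m ≤ n := ⟨m + L, by omega, by omega⟩
  have hq : (N : ℝ) < (N + n : ℕ) * p := by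
    rw [div_lt_iff₀ (by positivity)] at hp₁
    have : (m : ℝ) ≤ n := by exact_mod_cast hmn
    push_cast
    nlinarith
  obtain ⟨A, hAN, hA⟩ : ∃ A : ℝ, 40 * N ≤ A ∧ 20 ≤ A := ⟨40 * N, le_rfl, by linarith⟩
  have hA0 : 0 < A := by linarith
  obtain ⟨d, e, ρ, he, hρs, hρ, hdual, hexp⟩ := exists_dual_polynomials N n
  obtain ⟨S⟩ : Nonempty (DualSystem N n) := ⟨⟨d, e, ρ, he, hρs, hρ, hdual, hexp⟩⟩
  obtain ⟨C, hC⟩ := S.exists_boundedBy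
  obtain ⟨H, hH, hcut⟩ := exists_whitneyCutoff_bound N n hA
  have hH0 : 0 ≤ H := by linarith
  obtain ⟨C₁, hC₁, happrox⟩ := hφ₀.exists_norm_le_of_grandMax_le L
  obtain ⟨C₂, hC₂, herr⟩ := S.exists_error_bound hLn hC hH0
  obtain ⟨C₃, hC₃, hderiv⟩ := S.exists_supDeriv_atom_bound hC hH0 hmn
  obtain ⟨C₄, hC₄, hmax⟩ := S.exists_lintegral_maximal_atom hφ₀ hLn hC hH hp hq
    (C₀ := (A + 11) ^ (L + N)) (by positivity)
  set C₀ : ℝ := (A + 11) ^ (L + N) with hC₀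
  have hC₀0 : 0 ≤ C₀ := by positivity
  set V : ℝ := (6 * A + 1) ^ N with hV
  have hV0 : 0 ≤ V := by positivity
  set D : ℝ := V * (C₂ * C₀) with hD
  have hD0 : 0 ≤ D := by positivity
  refine ⟨1 + V + D + C₁ + C₃ + C₄, by positivity, fun f hf hc α hα => ?_⟩
  have hfm : ContDiff ℝ (m : ℕ∞) f := hf.of_le (by exact_mod_cast (by omega : m ≤ 2 * m - 1))
  have hfc : Continuous f := hf.continuous
  obtain ⟨Ω, hΩ⟩ : ∃ Ω, Ω = {x | ENNReal.ofReal α < grandMax L f x} := ⟨_, rfl⟩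
  have hΩo : IsOpen Ω := hΩ ▸ isOpen_lt_grandMax L f _
  have hΩb : Bornology.IsBounded Ω := hΩ ▸ isBounded_lt_grandMax hN hfc hc hα
  have hΩn : Ωᶜ.Nonempty := by
    have : Nonempty (Fin N) := ⟨⟨0, hN⟩⟩
    rw [Set.nonempty_compl]
    rintro rfl
    exact NormedSpace.unbounded_univ ℝ (RN N) hΩb
  have hΩM : ∀ x ∉ Ω, grandMax L f x ≤ ENNReal.ofReal α := fun x hx => by
    rw [hΩ] at hx
    exact not_lt.1 hx
  obtain ⟨K, c, r, h⟩ := exists_isWhitney hΩo hΩb hΩn hA0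
  have hη := fun k hk => hcut Ω K c r h k hk
  have htest := fun k (hk : k ∈ K) => h.exists_testBound hΩo hΩn hA0.le hα.le hΩM hk
  have hcb := fun k (hk : k ∈ K) => h.cube_subset_closedBall hAN hk
  have hcΩ := fun k (hk : k ∈ K) => (hcb k hk).trans (h.closedBall_subset hA0 hk)
  have hbc : ∀ k ∈ K, closedBall (c k) (10 * r k) ⊆ cube (c k) (40 * r k) := fun k hk =>
    (closedBall_subset_closedBall (by linarith [h.pos k hk])).trans (closedBall_subset_cube _ _)
  set β : ℕ → RN N → ℂ := fun k => S.atom (c k) (r k) (whitneyCutoff K c r k) f with hβ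
  have hβ0 : ∀ k ∈ K, ∀ x ∉ closedBall (c k) (10 * r k), β k x = 0 := fun k hk x hx =>
    S.atom_eq_zero (h.pos k hk) (hη k hk) f hx
  refine ⟨K, fun x => f x - ∑' k : K, β k x, β, c, fun k => 40 * r k, fun x => ?_,
    fun x => (sub_add_cancel _ _).symm, Eventually.of_forall fun x => ?_, fun k hk => ?_,
    fun x => ?_, ?_⟩
  · refine (h.overlap hA0 x).1.subset fun k hk => ⟨hk.1, ?_⟩
    by_contra hx
    exact hk.2 (hβ0 k hk.1 x fun hx' => hx (hcb k hk.1 (hbc k hk.1 hx')))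
  · suffices hs : ‖f x - ∑' k : K, β k x‖ ≤ (D + C₁) * α from
      hs.trans (mul_le_mul_of_nonneg_right (by linarith) hα.le)
    rw [h.tsum_eq_sum hA (u := fun k => β k x) x fun k hk => hβ0 k hk x]
    set s := (h.overlap hA0 x).1.toFinset with hs
    have hsK : ∀ k ∈ s, k ∈ K ∧ x ∈ closedBall (c k) (A / 2 * r k) := fun k hk =>
      (h.overlap hA0 x).1.mem_toFinset.1 hk
    by_cases hx : x ∈ Ω
    · have h1 := h.sum_whitneyCutoff hA hx (s := s) (fun k hk => (hsK k hk).1)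
        fun k hk hxk => (Set.Finite.mem_toFinset _).2 ⟨hk, hxk⟩
      have h2 : f x - ∑ k ∈ s, β k x = ∑ k ∈ s, (whitneyCutoff K c r k x • f x - β k x) := by
        rw [Finset.sum_sub_distrib, ← Finset.sum_smul, h1, one_smul]
      have h3 : (s.card : ℝ) ≤ V := by
        rw [hs, ← Set.ncard_eq_toFinset_card _ (h.overlap hA0 x).1]
        exact (h.overlap hA0 x).2
      rw [h2]
      calc ‖∑ k ∈ s, (whitneyCutoff K c r k x • f x - β k x)‖
          ≤ s.card • (C₂ * (C₀ * α)) :=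
            (norm_sum_le _ _).trans (Finset.sum_le_card_nsmul _ _ _ fun k hk =>
              herr _ _ _ (h.pos k (hsK k hk).1) (hη k (hsK k hk).1) f _ hfc (by positivity)
                (htest k (hsK k hk).1) x)
        _ ≤ V * (C₂ * (C₀ * α)) := by
            rw [nsmul_eq_mul]
            gcongr
        _ = D * α := by rw [hD]; ring
        _ ≤ (D + C₁) * α := by gcongr; linarith
    · rw [Finset.sum_eq_zero fun k hk => hβ0 k (hsK k hk).1 x fun hxk =>
        hx (hcΩ k (hsK k hk).1 (hbc k (hsK k hk).1 hxk)), sub_zero]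
      exact (happrox f α x hfc hα (hΩM x hx)).trans (by gcongr; linarith)
  · have hr := h.pos k hk
    have hder := hderiv (c k) (r k) _ hr (hη k hk) f hfm hc
    refine ⟨by positivity, S.atom_contDiff (hη k hk) hfm,
      (S.atom_tsupport hr (hη k hk) f).trans (hbc k hk), fun i hi => ?_, fun i hi him => ?_, ?_,
      fun γ hγ => ?_⟩
    · have h1 : (40 * r k) ^ (m + 0 - i) * supDeriv (m + 0) f ≤
          ∑ j ∈ Finset.range (i + 1), (40 * r k) ^ (m + j - i) * supDeriv (m + j) f :=
        Finset.single_le_sum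
          (f := fun j => (40 * r k) ^ (m + j - i) * supDeriv (m + j) f)
          (fun j _ => mul_nonneg (by positivity) (supDeriv_nonneg _ _)) (by simp)
      have h2 := supDeriv_nonneg m f
      calc supDeriv i (β k) ≤ C₃ * (r k ^ (m - i) * supDeriv m f) :=
            hder i m (by omega) le_rfl
        _ ≤ C₃ * ((40 * r k) ^ (m + 0 - i) * supDeriv (m + 0) f) := by
            rw [add_zero]
            gcongr
            linarith
        _ ≤ C₃ * ∑ j ∈ Finset.range (i + 1), (40 * r k) ^ (m + j - i) * supDeriv (m + j) f := by
            gcongr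
        _ ≤ _ := mul_le_mul_of_nonneg_right (by linarith)
            (Finset.sum_nonneg fun j _ => mul_nonneg (by positivity) (supDeriv_nonneg _ _))
    · have h1 := hder i i le_rfl him
      rw [Nat.sub_self, pow_zero, one_mul] at h1
      exact h1.trans (mul_le_mul_of_nonneg_right (by linarith) (supDeriv_nonneg i f))
    · refine (hmax (c k) (r k) _ hr (hη k hk) f α hfc hα (htest k hk) (hΩ ▸ hcΩ k hk)).trans ?_
      gcongr
      linarith
    · have h1 := S.integral_poly_smul_atom hr (hη k hk) hfc
        (monomial_mem_polySpace (n := n) γ (by omega))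
      rw [← h1]
      congr 1 with x
      rw [Complex.real_smul]
      push_cast
      rfl
  · have hsub : {k | k ∈ K ∧ x ∈ cube (c k) (40 * r k)} ⊆
        {k | k ∈ K ∧ x ∈ closedBall (c k) (A / 2 * r k)} := fun k hk => ⟨hk.1, hcb k hk.1 hk.2⟩
    have hov := h.overlap hA0 x
    refine ⟨hov.1.subset hsub, ?_⟩
    calc _ ≤ (({k | k ∈ K ∧ x ∈ closedBall (c k) (A / 2 * r k)}.ncard : ℕ) : ℝ) := by
          exact_mod_cast Set.ncard_le_ncard hsub hov.1
      _ ≤ V := hov.2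
      _ ≤ _ := by linarith
  · rw [← hΩ]
    refine Set.Subset.antisymm (Set.iUnion₂_subset hcΩ) fun x hx => ?_
    obtain ⟨k, hk, hxk⟩ := h.cover x hx
    exact Set.mem_biUnion hk
      (hbc k hk (closedBall_subset_closedBall (by linarith [h.pos k hk]) hxk))
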